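/- arXiv:0811.0686 — 3 statements merged into one kernel-verified Lean document; each statement's English description precedes it below -/
import Mathlib

section
/- Let k be a positive integer, 0 < h with kh ≤ 1, and let f : ℝ → ℝ be continuous and 1-periodic with sup norm ‖f‖_∞. Then the k-th derivative of the periodic convolution f * χ_h^k satisfies the uniform bound ‖D^k(f * χ_h^k)‖_∞ ≤ (h/2)^{−k} ‖f‖_∞. -/
open Real MeasureTheory

noncomputable section
open scoped Classical

/-- 1-periodization of the normalized indicator of `(-h/2, h/2)`:
equal on one period to `h⁻¹` on `(-h/2, h/2)` and `0` elsewhere. -/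
def chi (h : ℝ) (x : ℝ) : ℝ :=
  if ∃ m : ℤ, |x - m| < h / 2 then h⁻¹ else 0

/-- Periodic convolution of 1-periodic functions: `(f*g)(x) = ∫_0^1 f(u) g(x-u) du`. -/
def pconv (f g : ℝ → ℝ) (x : ℝ) : ℝ := ∫ u in (0:ℝ)..1, f u * g (x - u)

/-- The `k`-fold periodic self-convolution `χ_h^k` (B-spline): `χ_h^1 = χ_h`,
`χ_h^{k+1} = χ_h * χ_h^k`. -/
def chiK (h : ℝ) : ℕ → ℝ → ℝ
  | 0 => fun _ => 0
  | 1 => chi h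
  | (k + 2) => pconv (chi h) (chiK h (k + 1))

/-- The average of `g` over the interval of length `h` centred at `x`. -/
def movingAvg (h : ℝ) (g : ℝ → ℝ) (x : ℝ) : ℝ := h⁻¹ * ∫ v in (-(h / 2))..(h / 2), g (x - v)

lemma chi_periodic (h : ℝ) : Function.Periodic (chi h) 1 := by
  intro x
  unfold chi
  congr 1
  refine propext ⟨fun ⟨m, hm⟩ => ⟨m - 1, ?_⟩, fun ⟨m, hm⟩ => ⟨m + 1, ?_⟩⟩
  · push_cast
    rwa [show x - ((m : ℝ) - 1) = x + 1 - m by ring]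
  · push_cast
    rwa [show x + 1 - ((m : ℝ) + 1) = x - m by ring]

lemma measurable_chi (h : ℝ) : Measurable (chi h) := by
  have hs : IsOpen {x : ℝ | ∃ m : ℤ, |x - m| < h / 2} := by
    simp only [Set.ofPred_exists]
    exact isOpen_iUnion fun m => isOpen_lt (by fun_prop) continuous_const
  exact Measurable.ite hs.measurableSet measurable_const measurable_const

lemma norm_chi_le {h : ℝ} (hh : 0 < h) (x : ℝ) : ‖chi h x‖ ≤ h⁻¹ := by
  have := inv_nonneg.2 hh.le
  unfold chi
  split_ifs <;> simp [this, abs_of_pos hh]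

lemma chi_eq_indicator {h : ℝ} (h1 : h ≤ 1) {u : ℝ} (hu : u ∈ Set.Ioo (-(1 / 2) : ℝ) (1 / 2)) :
    chi h u = (Set.Ioo (-(h / 2)) (h / 2)).indicator (fun _ => h⁻¹) u := by
  unfold chi Set.indicator
  congr 1
  refine propext ⟨fun ⟨m, hm⟩ => ?_, fun hu' => ⟨0, by simpa [abs_lt] using hu'⟩⟩
  rw [abs_lt] at hm
  have h₁ : (m : ℝ) < 1 := by linarith [hu.2, hm.1]
  have h₂ : (-1 : ℝ) < m := by linarith [hu.1, hm.2]
  have h₃ : m = 0 := by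
    have h₁' : m < 1 := by exact_mod_cast h₁
    have h₂' : -1 < m := by exact_mod_cast h₂
    omega
  subst h₃
  simpa using hm

lemma pconv_comm {f g : ℝ → ℝ} (hf : Function.Periodic f 1) (hg : Function.Periodic g 1) :
    pconv f g = pconv g f := by
  funext x
  have hp : Function.Periodic (fun v => f (x - v) * g v) 1 := by
    intro v
    show f (x - (v + 1)) * g (v + 1) = f (x - v) * g v
    rw [hg v, ← sub_sub, hf.sub_eq]
  have hsub := intervalIntegral.integral_comp_sub_left (a := 0) (b := 1)
    (fun v => f (x - v) * g v) x
  simp only [sub_sub_cancel, sub_zero] at hsub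
  have hshift := hp.intervalIntegral_add_eq (x - 1) 0
  rw [sub_add_cancel, zero_add] at hshift
  unfold pconv
  rw [hsub, hshift]
  simp only [mul_comm]

lemma pconv_chi_left {h : ℝ} (hh : 0 < h) (h1 : h ≤ 1) {g : ℝ → ℝ}
    (hg : Function.Periodic g 1) : pconv (chi h) g = movingAvg h g := by
  funext x
  have hp : Function.Periodic (fun u => chi h u * g (x - u)) 1 := by
    intro u
    show chi h (u + 1) * g (x - (u + 1)) = chi h u * g (x - u)
    rw [chi_periodic h u, ← sub_sub, hg.sub_eq]
  have hshift := hp.intervalIntegral_add_eq 0 (-(1 / 2))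
  rw [zero_add, show (-(1 / 2) : ℝ) + 1 = 1 / 2 by norm_num] at hshift
  unfold pconv movingAvg
  rw [hshift, intervalIntegral.integral_of_le (by norm_num),
    intervalIntegral.integral_of_le (by linarith), integral_Ioc_eq_integral_Ioo,
    integral_Ioc_eq_integral_Ioo, ← integral_const_mul]
  have hind : ∀ u ∈ Set.Ioo (-(1 / 2) : ℝ) (1 / 2), chi h u * g (x - u) =
      (Set.Ioo (-(h / 2)) (h / 2)).indicator (fun v => h⁻¹ * g (x - v)) u := by
    intro u hu
    rw [chi_eq_indicator h1 hu, Set.indicator_mul_left]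
  rw [setIntegral_congr_fun measurableSet_Ioo hind, setIntegral_indicator measurableSet_Ioo,
    Set.inter_eq_right.2 (Set.Ioo_subset_Ioo (by linarith) (by linarith))]

lemma movingAvg_periodic (h : ℝ) {g : ℝ → ℝ} (hg : Function.Periodic g 1) :
    Function.Periodic (movingAvg h g) 1 := by
  intro x
  unfold movingAvg
  congr 2
  funext v
  rw [add_sub_right_comm, hg]

lemma measurable_movingAvg {h : ℝ} (hh : 0 < h) {g : ℝ → ℝ} (hg : Measurable g) :
    Measurable (movingAvg h g) := by
  unfold movingAvg
  simp only [intervalIntegral.integral_of_le (show -(h / 2) ≤ h / 2 by linarith)]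
  refine Measurable.const_mul (StronglyMeasurable.measurable ?_) _
  refine StronglyMeasurable.integral_prod_right (f := fun x v => g (x - v)) ?_
  exact (hg.comp (measurable_fst.sub measurable_snd)).stronglyMeasurable

lemma norm_movingAvg_le {h : ℝ} (hh : 0 < h) {g : ℝ → ℝ} {C : ℝ} (hC : ∀ x, ‖g x‖ ≤ C) (x : ℝ) :
    ‖movingAvg h g x‖ ≤ C := by
  have hb := intervalIntegral.norm_integral_le_of_norm_le_const (a := -(h / 2)) (b := h / 2)
    (f := fun v => g (x - v)) (C := C) fun v _ => hC _
  rw [show h / 2 - -(h / 2) = h by ring, abs_of_pos hh] at hb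
  unfold movingAvg
  rw [norm_mul, norm_inv, Real.norm_of_nonneg hh.le, inv_mul_le_iff₀ hh, mul_comm h]
  exact hb

lemma pconv_movingAvg (h : ℝ) {f g : ℝ → ℝ} (hf : Continuous f)
    (hg : Measurable g) {C : ℝ} (hC : ∀ x, ‖g x‖ ≤ C) :
    pconv f (movingAvg h g) = movingAvg h (pconv f g) := by
  funext x
  unfold pconv movingAvg
  have hint : IntegrableOn (Function.uncurry fun u v => f u * g (x - u - v))
      (Set.uIoc (0 : ℝ) 1 ×ˢ Set.uIoc (-(h / 2)) (h / 2)) := by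
    obtain ⟨B, hB⟩ := isCompact_uIcc.exists_bound_of_continuousOn
      (hf.continuousOn (s := Set.uIcc (0 : ℝ) 1))
    have hmeas : Measurable (Function.uncurry fun u v => f u * g (x - u - v)) :=
      (hf.measurable.comp measurable_fst).mul
        (hg.comp ((measurable_const.sub measurable_fst).sub measurable_snd))
    refine Measure.integrableOn_of_bounded (M := B * C) ?_ hmeas.aestronglyMeasurable ?_
    · rw [Measure.volume_eq_prod, Measure.prod_prod]
      simp [Set.uIoc]
    · refine (ae_restrict_iff' (measurableSet_uIoc.prod measurableSet_uIoc)).2 (ae_of_all _ ?_)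
      rintro ⟨u, v⟩ ⟨hu, -⟩
      have hBu := hB u (Set.uIoc_subset_uIcc hu)
      simp only [Function.uncurry_apply_pair, norm_mul]
      exact mul_le_mul hBu (hC _) (norm_nonneg _) ((norm_nonneg _).trans hBu)
  have hswap := intervalIntegral_intervalIntegral_swap hint
  simp only [intervalIntegral.integral_const_mul] at hswap
  simp only [mul_left_comm _ h⁻¹, intervalIntegral.integral_const_mul]
  rw [hswap]
  simp only [sub_right_comm]

lemma chiK_succ_periodic_measurable_bounded {h : ℝ} (hh : 0 < h) (h1 : h ≤ 1) (k : ℕ) :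
    Function.Periodic (chiK h (k + 1)) 1 ∧ Measurable (chiK h (k + 1)) ∧
      (∀ x, ‖chiK h (k + 1) x‖ ≤ h⁻¹) := by
  induction k with
  | zero => exact ⟨chi_periodic h, measurable_chi h, norm_chi_le hh⟩
  | succ k ih =>
    obtain ⟨hp, hm, hC⟩ := ih
    have heq : chiK h (k + 2) = movingAvg h (chiK h (k + 1)) := pconv_chi_left hh h1 hp
    rw [heq]
    exact ⟨movingAvg_periodic h hp, measurable_movingAvg hh hm, norm_movingAvg_le hh hC⟩

lemma pconv_chiK {h : ℝ} (hh : 0 < h) (h1 : h ≤ 1) {f : ℝ → ℝ} (hf : Continuous f)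
    (hper : Function.Periodic f 1) (k : ℕ) :
    pconv f (chiK h (k + 1)) = (movingAvg h)^[k + 1] f := by
  induction k with
  | zero =>
    show pconv f (chi h) = movingAvg h f
    rw [pconv_comm hper (chi_periodic h), pconv_chi_left hh h1 hper]
  | succ k ih =>
    obtain ⟨hp, hm, hC⟩ := chiK_succ_periodic_measurable_bounded hh h1 k
    rw [Function.iterate_succ_apply', ← ih, ← pconv_movingAvg h hf hm hC,
      ← pconv_chi_left hh h1 hp, chiK]

lemma hasDerivAt_movingAvg (h : ℝ) {g : ℝ → ℝ} (hg : Continuous g) (x : ℝ) :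
    HasDerivAt (movingAvg h g) (h⁻¹ * (g (x + h / 2) - g (x - h / 2))) x := by
  have hG : ∀ y, HasDerivAt (fun z => ∫ t in (0 : ℝ)..z, g t) (g y) y := fun y =>
    hg.integral_hasStrictDerivAt 0 y |>.hasDerivAt
  have heq : movingAvg h g = fun y =>
      h⁻¹ * ((∫ t in (0 : ℝ)..(y + h / 2), g t) - ∫ t in (0 : ℝ)..(y - h / 2), g t) := by
    funext y
    rw [intervalIntegral.integral_interval_sub_left (hg.intervalIntegrable _ _)
      (hg.intervalIntegrable _ _), movingAvg, intervalIntegral.integral_comp_sub_left,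
      sub_neg_eq_add]
  rw [heq]
  exact (((hG _).comp_add_const x (h / 2)).sub ((hG _).comp_sub_const x (h / 2))).const_mul _

lemma contDiff_iterate_movingAvg {h : ℝ} (hh : 0 < h) {f : ℝ → ℝ} (hf : Continuous f) {M : ℝ}
    (hM : ∀ x, |f x| ≤ M) (k : ℕ) :
    ContDiff ℝ k ((movingAvg h)^[k] f) ∧
      ∀ x, |iteratedDeriv k ((movingAvg h)^[k] f) x| ≤ ((h / 2) ^ k)⁻¹ * M := by
  induction k with
  | zero => simpa using ⟨hf, hM⟩
  | succ k ih =>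
    rw [Function.iterate_succ_apply']
    set F := (movingAvg h)^[k] f
    obtain ⟨hF, hb⟩ := ih
    have hder := hasDerivAt_movingAvg h hF.continuous
    have hd : deriv (movingAvg h F) = fun x => h⁻¹ * (F (x + h / 2) - F (x - h / 2)) :=
      funext fun x => (hder x).deriv
    have hplus : ContDiff ℝ k fun x => F (x + h / 2) := hF.comp (by fun_prop)
    have hminus : ContDiff ℝ k fun x => F (x - h / 2) := hF.comp (by fun_prop)
    constructor
    · push_cast
      refine contDiff_succ_iff_deriv.2 ⟨fun x => (hder x).differentiableAt, by simp, ?_⟩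
      rw [hd]
      exact contDiff_const.mul (hplus.sub hminus)
    · intro x
      rw [iteratedDeriv_succ', hd, iteratedDeriv_const_mul_field,
        iteratedDeriv_fun_sub hplus.contDiffAt hminus.contDiffAt, iteratedDeriv_comp_add_const,
        iteratedDeriv_comp_sub_const, abs_mul, abs_of_pos (inv_pos.2 hh)]
      calc _ ≤ h⁻¹ * (((h / 2) ^ k)⁻¹ * M + ((h / 2) ^ k)⁻¹ * M) := by
            gcongr
            exact (abs_sub _ _).trans (add_le_add (hb _) (hb _))
        _ = _ := by
            rw [pow_succ]
            field_simp
            ring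

theorem deriv_bound_convolution_with_Bspline (k : ℕ) (hk : 0 < k)
    (h : ℝ) (hh : 0 < h) (hkh : (k : ℝ) * h ≤ 1)
    (f : ℝ → ℝ) (hf : Continuous f) (hper : Function.Periodic f 1) :
    ∀ x : ℝ, |iteratedDeriv k (pconv f (chiK h k)) x|
      ≤ ((h / 2) ^ k)⁻¹ * ⨆ y : ℝ, |f y| := by
  obtain ⟨k, rfl⟩ := Nat.exists_eq_add_one.2 hk
  have h1 : h ≤ 1 := by
    push_cast at hkh
    nlinarith [mul_nonneg (Nat.cast_nonneg (α := ℝ) k) hh.le]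
  have hbdd : BddAbove (Set.range fun y => |f y|) :=
    (Function.Periodic.isBounded_of_continuous (hper.comp abs) one_ne_zero hf.abs).bddAbove
  rw [pconv_chiK hh h1 hf hper]
  exact (contDiff_iterate_movingAvg hh hf (fun x => le_ciSup hbdd x) (k + 1)).2
end
end

section
/- Let k, n be positive integers and 0 < h with kh ≤ 1. Let g : ℝ → ℝ be a continuous 1-periodic function orthogonal to all trigonometric polynomials of degree at most n−1, i.e. ∫_0^1 g(u) e^{−2πiju} du = 0 for every integer j with |j| ≤ n−1. Then ‖g * χ_h^k‖_∞ ≤ 𝒦_k (π n h)^{−k} ‖g‖_∞, where 𝒦_k = (4/π) Σ_{j∈ℤ} (4j+1)^{−(k+1)} is the k-th Favard constant. -/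
open Real MeasureTheory

noncomputable section
open scoped Classical

/-- The `k`-th Favard constant `𝒦_k = (4/π) ∑_{j ∈ ℤ} (4j+1)^{-(k+1)}`. -/
def favard (k : ℕ) : ℝ := (4 / π) * ∑' j : ℤ, 1 / (4 * (j : ℝ) + 1) ^ (k + 1)

/-- `F_k = (2/π)^k 𝒦_k`. -/
def Fconst (k : ℕ) : ℝ := (2 / π) ^ k * favard k


/-! ### The periodized indicator and its convolution powers -/

lemma chi_nonneg {h : ℝ} (hh : 0 < h) (x : ℝ) : 0 ≤ chi h x := by
  unfold chi; split_ifs <;> positivity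

lemma chi_le {h : ℝ} (hh : 0 < h) (x : ℝ) : chi h x ≤ h⁻¹ := by
  unfold chi; split_ifs
  · exact le_rfl
  · positivity

lemma chi_of_abs_lt {h t : ℝ} (ht : |t| < h / 2) : chi h t = h⁻¹ := by
  unfold chi
  rw [if_pos ⟨0, by simpa using ht⟩]

lemma chi_of_le_abs {h t : ℝ} (hle : h ≤ 1) (ht : h / 2 ≤ |t|) (ht' : |t| ≤ 1 / 2) :
    chi h t = 0 := by
  unfold chi
  rw [if_neg]
  rintro ⟨m, hm⟩
  rcases eq_or_ne m 0 with rfl | hm0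
  · simp at hm; linarith
  · have h1 : (1 : ℝ) ≤ |(m : ℝ)| := by exact_mod_cast Int.one_le_abs hm0
    have h2 : |(m : ℝ)| - |t| ≤ |t - m| := by
      rw [abs_sub_comm]; exact abs_sub_abs_le_abs_sub _ _
    linarith

/-- Convolution with `chi h` is the sliding mean over an interval of length `h`. -/
lemma pconv_chi {h : ℝ} (hle : h ≤ 1) {f : ℝ → ℝ} (hp : Function.Periodic f 1) (x : ℝ)
    (hh : 0 < h) :
    pconv f (chi h) x = h⁻¹ * ∫ u in (x - h / 2)..(x + h / 2), f u := by
  have hper : Function.Periodic (fun u => f u * chi h (x - u)) 1 := by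
    intro u
    have := chi_periodic h (x - (u + 1))
    simp only [hp u]
    rw [← this]; congr 2; ring
  have h1 : pconv f (chi h) x = ∫ u in (x - 1 / 2)..(x - 1 / 2 + 1), f u * chi h (x - u) := by
    rw [hper.intervalIntegral_add_eq (x - 1 / 2) 0]; simp [pconv]
  rw [h1, show x - 1 / 2 + 1 = x + 1 / 2 by ring,
    intervalIntegral.integral_of_le (by linarith), intervalIntegral.integral_of_le (by linarith),
    integral_Ioc_eq_integral_Ioo (x := x - h / 2), ← integral_const_mul]
  have hs : Set.Ioo (x - h / 2) (x + h / 2)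
      = Set.Ioc (x - 1 / 2) (x + 1 / 2) ∩ Set.Ioo (x - h / 2) (x + h / 2) := by
    ext u; simp only [Set.mem_inter_iff, Set.mem_Ioo, Set.mem_Ioc]
    constructor
    · rintro ⟨ha, hb⟩; refine ⟨⟨?_, ?_⟩, ha, hb⟩ <;> linarith
    · exact fun hu => hu.2
  rw [hs, ← setIntegral_indicator measurableSet_Ioo]
  refine setIntegral_congr_fun measurableSet_Ioc fun u hu => ?_
  simp only [Set.indicator, Set.mem_Ioo, Set.mem_Ioc] at hu ⊢
  split_ifs with hu'
  · rw [chi_of_abs_lt (abs_lt.2 ⟨by linarith, by linarith⟩), mul_comm]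
  · rw [chi_of_le_abs hle _ (abs_le.2 ⟨by linarith, by linarith⟩), mul_zero]
    by_contra hcon
    rw [not_le, abs_lt] at hcon
    exact hu' ⟨by linarith, by linarith⟩

lemma measurable_pconv {f c : ℝ → ℝ} (hf : Measurable f) (hc : Measurable c) :
    Measurable (pconv f c) := by
  have h1 : Measurable fun p : ℝ × ℝ => f p.2 * c (p.1 - p.2) := by fun_prop
  have h2 := (h1.stronglyMeasurable.integral_prod_right'
    (ν := volume.restrict (Set.Ioc (0 : ℝ) 1))).measurable
  convert h2 using 2 with x
  simp [pconv, intervalIntegral.integral_of_le]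

lemma abs_pconv_le {f c : ℝ → ℝ} {A B : ℝ} (hf : ∀ x, |f x| ≤ A) (hc : ∀ x, |c x| ≤ B) (x : ℝ) :
    |pconv f c x| ≤ A * B := by
  have hA : 0 ≤ A := (abs_nonneg _).trans (hf 0)
  have := intervalIntegral.norm_integral_le_of_norm_le_const (a := 0) (b := 1) (C := A * B)
    (f := fun u => f u * c (x - u)) (fun u _ => by
      rw [Real.norm_eq_abs, abs_mul]
      exact mul_le_mul (hf u) (hc _) (abs_nonneg _) hA)
  simpa [pconv] using this

lemma pconv_periodic {f c : ℝ → ℝ} (hc : Function.Periodic c 1) :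
    Function.Periodic (pconv f c) 1 := by
  intro x
  unfold pconv
  refine intervalIntegral.integral_congr fun u _ => ?_
  rw [show x + 1 - u = x - u + 1 by ring, hc]

/-- Associativity of periodic convolution, for bounded measurable functions. -/
lemma pconv_assoc {f c d : ℝ → ℝ} {A B C : ℝ} (hf : Measurable f) (hc : Measurable c)
    (hd : Measurable d) (hfA : ∀ x, |f x| ≤ A) (hcB : ∀ x, |c x| ≤ B) (hdC : ∀ x, |d x| ≤ C)
    (hcp : Function.Periodic c 1) (hdp : Function.Periodic d 1) (x : ℝ) :
    pconv f (pconv c d) x = pconv (pconv f c) d x := by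
  have hA : 0 ≤ A := (abs_nonneg _).trans (hfA 0)
  have hB : 0 ≤ B := (abs_nonneg _).trans (hcB 0)
  have hshift : ∀ u, f u * pconv c d (x - u)
      = ∫ w in (0 : ℝ)..1, f u * (c (w - u) * d (x - w)) := by
    intro u
    have hper : Function.Periodic (fun w => c (w - u) * d (x - w)) 1 := by
      intro w
      simp only
      rw [show w + 1 - u = w - u + 1 by ring, hcp, ← hdp (x - (w + 1))]
      congr 2; ring
    rw [intervalIntegral.integral_const_mul]
    congr 1
    have h2 : pconv c d (x - u) = ∫ v in (0 : ℝ)..1, (fun w => c (w - u) * d (x - w)) (v + u) := by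
      unfold pconv
      refine intervalIntegral.integral_congr fun v _ => ?_
      simp only [add_sub_cancel_right]
      congr 2; ring
    rw [h2, intervalIntegral.integral_comp_add_right (fun w => c (w - u) * d (x - w)), zero_add, add_comm 1 u,
      hper.intervalIntegral_add_eq u 0, zero_add]
  have hlhs : pconv f (pconv c d) x
      = ∫ u in (0 : ℝ)..1, ∫ w in (0 : ℝ)..1, f u * (c (w - u) * d (x - w)) := by
    change (∫ u in (0 : ℝ)..1, f u * pconv c d (x - u)) = _
    exact intervalIntegral.integral_congr fun u _ => hshift u
  have hrhs : pconv (pconv f c) d x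
      = ∫ w in (0 : ℝ)..1, ∫ u in (0 : ℝ)..1, f u * (c (w - u) * d (x - w)) := by
    change (∫ w in (0 : ℝ)..1, pconv f c w * d (x - w)) = _
    refine intervalIntegral.integral_congr fun w _ => ?_
    simp only [pconv, ← intervalIntegral.integral_mul_const, mul_assoc]
  rw [hlhs, hrhs]
  simp only [intervalIntegral.integral_of_le zero_le_one]
  refine integral_integral_swap ?_
  refine Integrable.of_bound (C := A * (B * C)) ?_ ?_
  · have : Measurable (Function.uncurry fun u w => f u * (c (w - u) * d (x - w))) := by
      unfold Function.uncurry; fun_prop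
    exact this.aestronglyMeasurable
  · refine Filter.Eventually.of_forall fun p => ?_
    simp only [Function.uncurry, Real.norm_eq_abs, abs_mul]
    exact mul_le_mul (hfA _) (mul_le_mul (hcB _) (hdC _) (abs_nonneg _) hB)
      (by positivity) hA

lemma chiK_regular {h : ℝ} (hh : 0 < h) (k : ℕ) :
    Measurable (chiK h (k + 1)) ∧ Function.Periodic (chiK h (k + 1)) 1 ∧
      ∃ B, ∀ x, |chiK h (k + 1) x| ≤ B := by
  have hchi : ∀ x, |chi h x| ≤ h⁻¹ := fun x => by
    rw [abs_of_nonneg (chi_nonneg hh x)]; exact chi_le hh x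
  induction k with
  | zero => exact ⟨measurable_chi h, chi_periodic h, h⁻¹, hchi⟩
  | succ k ih =>
    obtain ⟨h1, h2, B, h3⟩ := ih
    exact ⟨measurable_pconv (measurable_chi h) h1, pconv_periodic h2, h⁻¹ * B,
      abs_pconv_le hchi h3⟩

lemma exists_abs_le_of_periodic {g : ℝ → ℝ} (hg : Continuous g) (hp : Function.Periodic g 1) :
    ∃ B, ∀ x, |g x| ≤ B := by
  obtain ⟨B, hB⟩ := (hp.isBounded_of_continuous one_ne_zero hg).exists_norm_le
  exact ⟨B, fun x => hB _ ⟨x, rfl⟩⟩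

/-- Convolving with the `k`-th power of `chi h` is `h ^ (-k)` times a `k`-th central difference of
the `k`-th primitive. -/
lemma abs_pconv_chiK_le {h : ℝ} (hh : 0 < h) (hle : h ≤ 1) (k : ℕ) :
    ∀ (Q : ℕ → ℝ → ℝ) (M : ℝ), (∀ m, Continuous (Q m)) → (∀ m, Function.Periodic (Q m) 1) →
      (∀ m x, HasDerivAt (Q (m + 1)) (Q m x) x) → (∀ x, |Q (k + 1) x| ≤ M) →
      ∀ x, |pconv (Q 0) (chiK h (k + 1)) x| ≤ (2 / h) ^ (k + 1) * M := by
  have key : ∀ (Q : ℕ → ℝ → ℝ), (∀ m, Continuous (Q m)) → (∀ m, Function.Periodic (Q m) 1) →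
      (∀ m x, HasDerivAt (Q (m + 1)) (Q m x) x) →
      ∀ x, pconv (Q 0) (chi h) x = h⁻¹ * (Q 1 (x + h / 2) - Q 1 (x - h / 2)) := by
    intro Q hc hp hd x
    rw [pconv_chi hle (hp 0) x hh, intervalIntegral.integral_eq_sub_of_hasDerivAt
      (fun y _ => hd 0 y) ((hc 0).intervalIntegrable _ _)]
  have diff_le : ∀ (q : ℝ → ℝ) (M : ℝ), (∀ x, |q x| ≤ M) → ∀ x,
      |h⁻¹ * (q (x + h / 2) - q (x - h / 2))| ≤ 2 / h * M := by
    intro q M hM x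
    rw [abs_mul, abs_of_pos (inv_pos.2 hh), show 2 / h * M = h⁻¹ * (2 * M) by ring]
    refine mul_le_mul_of_nonneg_left ?_ (by positivity)
    linarith [abs_sub (q (x + h / 2)) (q (x - h / 2)), hM (x + h / 2), hM (x - h / 2)]
  induction k with
  | zero =>
    intro Q M hc hp hd hM x
    change |pconv (Q 0) (chi h) x| ≤ _
    rw [key Q hc hp hd, zero_add, pow_one]
    exact diff_le _ _ hM x
  | succ k ih =>
    intro Q M hc hp hd hM x
    obtain ⟨h1, h2, B, h3⟩ := chiK_regular hh k
    obtain ⟨A, hA⟩ := exists_abs_le_of_periodic (hc 0) (hp 0)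
    have hchi : ∀ x, |chi h x| ≤ h⁻¹ := fun x => by
      rw [abs_of_nonneg (chi_nonneg hh x)]; exact chi_le hh x
    change |pconv (Q 0) (pconv (chi h) (chiK h (k + 1))) x| ≤ _
    rw [pconv_assoc (hc 0).measurable (measurable_chi h) h1 hA hchi h3 (chi_periodic h) h2,
      funext (key Q hc hp hd), pow_succ, mul_assoc]
    refine ih (fun m x => h⁻¹ * (Q (m + 1) (x + h / 2) - Q (m + 1) (x - h / 2))) _
      (fun m => ?_) (fun m y => ?_) (fun m y => ?_) (diff_le _ _ hM) x
    · have := hc (m + 1); fun_prop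
    · simp only
      rw [show y + 1 + h / 2 = y + h / 2 + 1 by ring, show y + 1 - h / 2 = y - h / 2 + 1 by ring,
        hp, hp]
    · exact (((hd (m + 1) _).comp_add_const y (h / 2)).sub
        ((hd (m + 1) _).comp_sub_const y (h / 2))).const_mul _

/-! ### Fourier coefficients of periodic functions -/

/-- The character `t ↦ exp (2πijt)`. -/
def expi (j : ℤ) (t : ℝ) : ℂ := Complex.exp (2 * π * Complex.I * j * t)

/-- The `j`-th Fourier coefficient of a function on `[0, 1]`. -/
def fc (f : ℝ → ℝ) (j : ℤ) : ℂ := ∫ u in (0 : ℝ)..1, (f u : ℂ) * expi (-j) u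

lemma norm_expi (j : ℤ) (t : ℝ) : ‖expi j t‖ = 1 := by
  rw [expi, show 2 * (π : ℂ) * Complex.I * j * t = ((2 * π * j * t : ℝ) : ℂ) * Complex.I by
    push_cast; ring, Complex.norm_exp_ofReal_mul_I]

@[fun_prop]
lemma continuous_expi (j : ℤ) : Continuous (expi j) := by unfold expi; fun_prop

lemma expi_add (j : ℤ) (s t : ℝ) : expi j (s + t) = expi j s * expi j t := by
  simp only [expi, ← Complex.exp_add]; congr 1; push_cast; ring

lemma expi_add_index (j l : ℤ) (t : ℝ) : expi (j + l) t = expi j t * expi l t := by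
  simp only [expi, ← Complex.exp_add]; congr 1; push_cast; ring

lemma expi_neg (j : ℤ) (t : ℝ) : expi j (-t) = expi (-j) t := by
  simp only [expi]; congr 1; push_cast; ring

lemma expi_mul (j : ℤ) (n : ℤ) (t : ℝ) : expi (n * j) t = expi j (n * t) := by
  simp only [expi]; congr 1; push_cast; ring

@[simp] lemma expi_zero (t : ℝ) : expi 0 t = 1 := by simp [expi]

@[simp] lemma expi_zero_right (j : ℤ) : expi j 0 = 1 := by simp [expi]

lemma expi_one_right (j : ℤ) : expi j 1 = 1 := by
  rw [expi, Complex.exp_eq_one_iff]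
  exact ⟨j, by push_cast; ring⟩

lemma expi_periodic (j : ℤ) : Function.Periodic (expi j) 1 := fun t => by
  rw [expi_add, expi_one_right, mul_one]

lemma hasDerivAt_expi (j : ℤ) (t : ℝ) :
    HasDerivAt (expi j) (2 * π * Complex.I * j * expi j t) t := by
  have h1 : HasDerivAt (fun y : ℝ => 2 * (π : ℂ) * Complex.I * j * (y : ℂ))
      (2 * π * Complex.I * j) t := by
    simpa using (Complex.ofRealCLM.hasDerivAt (x := t)).const_mul (2 * (π : ℂ) * Complex.I * j)
  have h2 := h1.cexp
  rw [mul_comm (Complex.exp _)] at h2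
  exact h2

lemma fourierCoeff_lift {f : ℝ → ℝ} (hp : Function.Periodic (fun u => (f u : ℂ)) (1 : ℝ)) (j : ℤ) :
    fourierCoeff (T := 1) hp.lift j = fc f j := by
  rw [fourierCoeff_eq_intervalIntegral _ j 0]
  simp only [div_one, one_smul, zero_add, fc]
  refine intervalIntegral.integral_congr fun u _ => ?_
  simp only [Function.Periodic.lift_coe, fourier_coe_apply, smul_eq_mul, expi]
  rw [mul_comm]
  congr 2
  push_cast
  ring

lemma summable_sq_fc {f : ℝ → ℝ} (hf : Continuous f) (hper : Function.Periodic f 1) :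
    Summable fun j => ‖fc f j‖ ^ 2 := by
  have hp : Function.Periodic (fun u => (f u : ℂ)) (1 : ℝ) := fun u => by simp only [hper u]
  have hc : Continuous (hp.lift : AddCircle (1 : ℝ) → ℂ) := by
    refine continuous_coinduced_dom.2 ?_
    change Continuous (fun u => (f u : ℂ))
    fun_prop
  have h1 := (hasSum_sq_fourierCoeff
    (ContinuousMap.toLp 2 AddCircle.haarAddCircle ℂ (⟨_, hc⟩ : C(AddCircle (1 : ℝ), ℂ)))).summable
  simp only [fourierCoeff_toLp, ContinuousMap.coe_mk] at h1
  simpa only [fourierCoeff_lift] using h1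

lemma hasSum_fc {f : ℝ → ℝ} (hf : Continuous f) (hper : Function.Periodic f 1)
    (hs : Summable (fc f)) (x : ℝ) : HasSum (fun j => fc f j * expi j x) (f x) := by
  have hp : Function.Periodic (fun u => (f u : ℂ)) (1 : ℝ) := fun u => by simp only [hper u]
  have hc : Continuous (hp.lift : AddCircle (1 : ℝ) → ℂ) := by
    refine continuous_coinduced_dom.2 ?_
    change Continuous (fun u => (f u : ℂ))
    fun_prop
  have h1 := has_pointwise_sum_fourier_series_of_summable
    (f := (⟨_, hc⟩ : C(AddCircle (1 : ℝ), ℂ))) (by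
      simpa only [ContinuousMap.coe_mk, funext (fourierCoeff_lift hp)] using hs) (x : AddCircle (1 : ℝ))
  simp only [ContinuousMap.coe_mk, fourierCoeff_lift, Function.Periodic.lift_coe,
    fourier_coe_apply, smul_eq_mul] at h1
  convert h1 using 3 with j
  simp [expi]

/-- The primitive of `f` with mean zero over `[0, 1]`. -/
def meanPrim (f : ℝ → ℝ) (x : ℝ) : ℝ := (∫ t in (0 : ℝ)..x, f t) - ∫ y in (0 : ℝ)..1, ∫ t in (0 : ℝ)..y, f t

lemma hasDerivAt_meanPrim {f : ℝ → ℝ} (hf : Continuous f) (x : ℝ) :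
    HasDerivAt (meanPrim f) (f x) x :=
  (hf.integral_hasStrictDerivAt 0 x).hasDerivAt.sub_const _

lemma continuous_meanPrim {f : ℝ → ℝ} (hf : Continuous f) : Continuous (meanPrim f) :=
  continuous_iff_continuousAt.2 fun x => (hasDerivAt_meanPrim hf x).continuousAt

lemma meanPrim_periodic {f : ℝ → ℝ} (hf : Continuous f) (hp : Function.Periodic f 1)
    (h0 : ∫ u in (0 : ℝ)..1, f u = 0) : Function.Periodic (meanPrim f) 1 := by
  intro x
  have h1 := hp.intervalIntegral_add_eq x 0
  rw [zero_add, h0] at h1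
  have h2 := intervalIntegral.integral_add_adjacent_intervals (hf.intervalIntegrable (μ := volume) 0 x)
    (hf.intervalIntegrable x (x + 1))
  rw [h1, add_zero] at h2
  rw [meanPrim, ← h2, meanPrim]

lemma integral_meanPrim {f : ℝ → ℝ} (hf : Continuous f) :
    ∫ u in (0 : ℝ)..1, meanPrim f u = 0 := by
  have hc : Continuous fun y => ∫ t in (0 : ℝ)..y, f t :=
    intervalIntegral.continuous_primitive (fun a b => hf.intervalIntegrable a b) 0
  unfold meanPrim
  rw [intervalIntegral.integral_sub (hc.intervalIntegrable _ _) (by simp)]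
  simp

lemma fc_zero (f : ℝ → ℝ) : fc f 0 = ((∫ u in (0 : ℝ)..1, f u : ℝ) : ℂ) := by
  simp [fc, intervalIntegral.integral_ofReal]

lemma fc_meanPrim {f : ℝ → ℝ} (hf : Continuous f) (hp : Function.Periodic f 1)
    (h0 : ∫ u in (0 : ℝ)..1, f u = 0) (j : ℤ) :
    fc (meanPrim f) j = fc f j / (2 * π * Complex.I * j) := by
  rcases eq_or_ne j 0 with rfl | hj
  · simp [fc_zero, integral_meanPrim hf]
  have hj' : (2 * π * Complex.I * j : ℂ) ≠ 0 := by
    simp [Real.pi_ne_zero, Complex.I_ne_zero, hj]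
  have h1 := intervalIntegral.integral_mul_deriv_eq_deriv_mul (a := 0) (b := 1)
    (u := fun x => (meanPrim f x : ℂ)) (u' := fun x => (f x : ℂ)) (v := expi (-j))
    (v' := fun x => 2 * π * Complex.I * ((-j : ℤ) : ℂ) * expi (-j) x)
    (fun x _ => (hasDerivAt_meanPrim hf x).ofReal_comp) (fun x _ => hasDerivAt_expi _ x)
    (Continuous.intervalIntegrable (by fun_prop) _ _)
    (Continuous.intervalIntegrable (by fun_prop) _ _)
  have h2 : meanPrim f 1 = meanPrim f 0 := by
    simpa using meanPrim_periodic hf hp h0 0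
  rw [h2, expi_one_right, expi_zero_right, sub_self, zero_sub] at h1
  have h3 : (∫ x in (0 : ℝ)..1, (meanPrim f x : ℂ) *
      (2 * π * Complex.I * ((-j : ℤ) : ℂ) * expi (-j) x))
      = -(2 * π * Complex.I * j) * fc (meanPrim f) j := by
    rw [fc, ← intervalIntegral.integral_const_mul]
    refine intervalIntegral.integral_congr fun x _ => ?_
    push_cast
    ring
  rw [h3] at h1
  rw [eq_div_iff hj', mul_comm]
  change _ = ∫ x in (0 : ℝ)..1, (f x : ℂ) * expi (-j) x
  linear_combination -h1

lemma iterate_meanPrim {g : ℝ → ℝ} (hg : Continuous g) (hp : Function.Periodic g 1)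
    (h0 : ∫ u in (0 : ℝ)..1, g u = 0) (m : ℕ) :
    Continuous (meanPrim^[m] g) ∧ Function.Periodic (meanPrim^[m] g) 1 ∧
      (∫ u in (0 : ℝ)..1, (meanPrim^[m] g) u = 0) ∧
      ∀ j : ℤ, fc (meanPrim^[m] g) j = fc g j / (2 * π * Complex.I * j) ^ m := by
  induction m with
  | zero => exact ⟨hg, hp, h0, by simp⟩
  | succ m ih =>
    obtain ⟨h1, h2, h3, h4⟩ := ih
    rw [Function.iterate_succ_apply']
    refine ⟨continuous_meanPrim h1, meanPrim_periodic h1 h2 h3, integral_meanPrim h1, fun j => ?_⟩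
    rw [fc_meanPrim h1 h2 h3, h4, div_div, pow_succ]

lemma summable_fc_div_pow {g : ℝ → ℝ} (hg : Continuous g) (hp : Function.Periodic g 1) (p : ℕ) :
    Summable fun j : ℤ => fc g j / (j : ℂ) ^ (p + 1) := by
  have h1 : Summable fun j : ℤ => (‖fc g j‖ ^ 2 + 1 / (j : ℝ) ^ 2) :=
    (summable_sq_fc hg hp).add (Real.summable_one_div_int_pow.2 one_lt_two)
  refine h1.of_norm_bounded fun j => ?_
  rcases eq_or_ne j 0 with rfl | hj
  · simp
  have hj1 : (1 : ℝ) ≤ |(j : ℝ)| := by exact_mod_cast Int.one_le_abs hj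
  have h2 : ‖fc g j / (j : ℂ) ^ (p + 1)‖ ≤ ‖fc g j‖ * (1 / |(j : ℝ)|) := by
    rw [norm_div, norm_pow, Complex.norm_intCast, div_eq_mul_one_div]
    refine mul_le_mul_of_nonneg_left ?_ (norm_nonneg _)
    exact one_div_le_one_div_of_le (by linarith) (le_self_pow₀ hj1 (by omega))
  have h3 : (1 : ℝ) / (j : ℝ) ^ 2 = (1 / |(j : ℝ)|) ^ 2 := by rw [div_pow, one_pow, sq_abs]
  rw [h3]
  nlinarith [sq_nonneg (‖fc g j‖ - 1 / |(j : ℝ)|), sq_nonneg (‖fc g j‖), sq_nonneg (1 / |(j : ℝ)|)]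

/-! ### The Poisson kernel and the extremal kernel -/

lemma hasSum_of_eq {ι : Type*} {f g : ι → ℂ} {a b : ℂ} (h : HasSum f a) (hfg : ∀ i, g i = f i)
    (hab : b = a) : HasSum g b := by
  rw [funext hfg, hab]; exact h

/-- The Poisson kernel `∑ r ^ |j| exp (2πijθ)` in closed form. -/
def pois (r θ : ℝ) : ℝ := (1 - r ^ 2) / Complex.normSq (1 - r * expi 1 θ)

lemma norm_mul_expi_lt {r : ℝ} (h0 : 0 ≤ r) (h1 : r < 1) (j : ℤ) (θ : ℝ) :
    ‖(r : ℂ) * expi j θ‖ < 1 := by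
  rwa [norm_mul, norm_expi, mul_one, Complex.norm_real, Real.norm_of_nonneg h0]

lemma one_sub_mul_expi_ne_zero {r : ℝ} (h0 : 0 ≤ r) (h1 : r < 1) (j : ℤ) (θ : ℝ) :
    1 - (r : ℂ) * expi j θ ≠ 0 := by
  intro h
  have := norm_mul_expi_lt h0 h1 j θ
  rw [← sub_eq_zero.1 h] at this
  simp at this

lemma pois_nonneg {r : ℝ} (h0 : 0 ≤ r) (h1 : r < 1) (θ : ℝ) : 0 ≤ pois r θ :=
  div_nonneg (by nlinarith) (Complex.normSq_nonneg _)

lemma continuous_pois {r : ℝ} (h0 : 0 ≤ r) (h1 : r < 1) : Continuous (pois r) := by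
  unfold pois
  refine Continuous.div (by fun_prop) (Complex.continuous_normSq.comp (by fun_prop)) fun θ => ?_
  rw [Ne, Complex.normSq_eq_zero]
  exact one_sub_mul_expi_ne_zero h0 h1 1 θ

lemma expi_nat (n : ℕ) (θ : ℝ) : expi n θ = expi 1 θ ^ n := by
  simp only [expi, ← Complex.exp_nat_mul]; congr 1; push_cast; ring

lemma conj_expi (j : ℤ) (θ : ℝ) : (starRingEnd ℂ) (expi j θ) = expi (-j) θ := by
  simp only [expi, ← Complex.exp_conj]; congr 1; simp [Complex.conj_ofNat]

lemma expi_mul_neg (j : ℤ) (θ : ℝ) : expi j θ * expi (-j) θ = 1 := by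
  rw [← expi_add_index, add_neg_cancel, expi_zero]

lemma hasSum_pois {r : ℝ} (h0 : 0 ≤ r) (h1 : r < 1) (θ : ℝ) :
    HasSum (fun j : ℤ => (r : ℂ) ^ j.natAbs * expi j θ) (pois r θ) := by
  have ha := hasSum_geometric_of_norm_lt_one (norm_mul_expi_lt h0 h1 1 θ)
  have hb := (hasSum_geometric_of_norm_lt_one (norm_mul_expi_lt h0 h1 (-1) θ)).mul_left
    ((r : ℂ) * expi (-1) θ)
  have hc := HasSum.of_nat_of_neg_add_one (f := fun j : ℤ => (r : ℂ) ^ j.natAbs * expi j θ)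
    (m := (1 - (r : ℂ) * expi 1 θ)⁻¹)
    (m' := (r : ℂ) * expi (-1) θ * (1 - (r : ℂ) * expi (-1) θ)⁻¹) ?_ ?_
  · convert hc using 1
    have e1 := one_sub_mul_expi_ne_zero h0 h1 1 θ
    have e2 := one_sub_mul_expi_ne_zero h0 h1 (-1) θ
    have e3 : ((Complex.normSq (1 - r * expi 1 θ) : ℝ) : ℂ)
        = (1 - r * expi 1 θ) * (1 - r * expi (-1) θ) := by
      rw [Complex.normSq_eq_conj_mul_self, mul_comm]
      simp [conj_expi]
    rw [pois, Complex.ofReal_div, e3]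
    push_cast
    field_simp
    linear_combination (r : ℂ) ^ 2 * expi_mul_neg 1 θ
  · refine hasSum_of_eq ha (fun n => ?_) rfl
    simp [expi_nat, mul_pow]
  · refine hasSum_of_eq hb (fun n => ?_) rfl
    rw [← pow_succ', mul_pow, show (-((n : ℤ) + 1)).natAbs = n + 1 by omega,
      ← expi_neg, ← expi_neg, ← expi_nat]
    push_cast
    rfl

/-- The kernel whose Fourier coefficients are `r ^ |j|` for `n ≤ j` and `σ * r ^ |j|` for `j ≤ -n`,
and which is the product of the Poisson kernel with a trigonometric monomial. -/
def extKer (n : ℕ) (σ r θ : ℝ) : ℂ :=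
  r ^ n * (expi n θ + σ * expi (-n) θ) * pois r θ / (1 + σ * r ^ (2 * n))

/-- The Fourier coefficients of `extKer`. -/
def extCoeff (n : ℕ) (σ r : ℝ) (j : ℤ) : ℝ :=
  r ^ n * (r ^ (j - n).natAbs + σ * r ^ (j + n).natAbs) / (1 + σ * r ^ (2 * n))

lemma hasSum_extKer (n : ℕ) (σ : ℝ) {r : ℝ} (h0 : 0 ≤ r) (h1 : r < 1) (θ : ℝ) :
    HasSum (fun j : ℤ => (extCoeff n σ r j : ℂ) * expi j θ) (extKer n σ r θ) := by
  have hP := hasSum_pois h0 h1 θ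
  have ha := ((Equiv.subRight (n : ℤ)).hasSum_iff.2 hP).mul_left (expi n θ)
  have hb := ((Equiv.addRight (n : ℤ)).hasSum_iff.2 hP).mul_left ((σ : ℂ) * expi (-n) θ)
  have hc := (ha.add hb).mul_left ((r : ℂ) ^ n / (1 + σ * r ^ (2 * n)))
  refine hasSum_of_eq hc (fun j => ?_) ?_
  · simp only [Function.comp, Equiv.subRight_apply, Equiv.coe_addRight]
    have e1 : expi j θ = expi n θ * expi (j - n) θ := by rw [← expi_add_index]; congr 1; ring
    have e2 : expi j θ = expi (-n) θ * expi (j + n) θ := by rw [← expi_add_index]; congr 1; ring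
    rw [extCoeff]
    push_cast
    linear_combination (r : ℂ) ^ n / (1 + σ * r ^ (2 * n)) * (r : ℂ) ^ (j - n).natAbs * e1 +
      (r : ℂ) ^ n / (1 + σ * r ^ (2 * n)) * σ * (r : ℂ) ^ (j + n).natAbs * e2
  · unfold extKer; ring

lemma summable_extCoeff (n : ℕ) (σ : ℝ) {r : ℝ} (h0 : 0 ≤ r) (h1 : r < 1) :
    Summable (extCoeff n σ r) := by
  have := (hasSum_extKer n σ h0 h1 0).summable
  simpa using this

lemma one_add_pos {n : ℕ} (hn : 0 < n) {σ r : ℝ} (hσ : σ ^ 2 = 1) (h0 : 0 ≤ r) (h1 : r < 1) :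
    0 < 1 + σ * r ^ (2 * n) := by
  have h2 : r ^ (2 * n) < 1 := pow_lt_one₀ h0 h1 (by omega)
  have h3 : 0 ≤ r ^ (2 * n) := by positivity
  rcases eq_or_eq_neg_of_sq_eq_sq σ 1 (by rw [hσ, one_pow]) with rfl | rfl <;> linarith

lemma extCoeff_of_le {n : ℕ} (hn : 0 < n) {σ r : ℝ} (hσ : σ ^ 2 = 1) (h0 : 0 ≤ r) (h1 : r < 1)
    {j : ℤ} (hj : (n : ℤ) ≤ |j|) :
    extCoeff n σ r j = (if 0 < j then 1 else σ) * r ^ j.natAbs := by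
  have hd := (one_add_pos hn hσ h0 h1).ne'
  rw [extCoeff, div_eq_iff hd]
  obtain ⟨m, hm⟩ : ∃ m : ℕ, j.natAbs = n + m :=
    ⟨j.natAbs - n, by rw [Int.abs_eq_natAbs] at hj; omega⟩
  split_ifs with hj0
  · rw [show (j - n).natAbs = m by omega, show (j + n).natAbs = 2 * n + m by omega, hm]
    ring
  · rw [show (j - n).natAbs = 2 * n + m by omega, show (j + n).natAbs = m by omega, hm]
    ring_nf
    rw [hσ]
    ring

lemma continuous_extKer (n : ℕ) (σ : ℝ) {r : ℝ} (h0 : 0 ≤ r) (h1 : r < 1) :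
    Continuous (extKer n σ r) := by
  have := continuous_pois h0 h1
  unfold extKer
  fun_prop

lemma extKer_periodic (n : ℕ) (σ r : ℝ) : Function.Periodic (extKer n σ r) 1 := fun θ => by
  simp only [extKer, pois, (expi_periodic _) θ]

/-- Convolution with the extremal kernel acts on functions without low frequencies as a
(signed) Poisson multiplier. -/
lemma hasSum_integral_mul_extKer {n : ℕ} (hn : 0 < n) {σ r : ℝ} (hσ : σ ^ 2 = 1) (h0 : 0 ≤ r)
    (h1 : r < 1) {f : ℝ → ℝ} {M : ℝ} (hf : Measurable f) (hM : ∀ u, |f u| ≤ M)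
    (hgap : ∀ j : ℤ, |j| < n → fc f j = 0) (x : ℝ) :
    HasSum (fun j : ℤ => fc f j * ((if 0 < j then 1 else σ : ℝ) * (r : ℂ) ^ j.natAbs) * expi j x)
      (∫ u in (0 : ℝ)..1, (f u : ℂ) * extKer n σ r (x - u)) := by
  have hs := summable_extCoeff n σ h0 h1
  have h := intervalIntegral.hasSum_integral_of_dominated_convergence (a := 0) (b := 1)
    (μ := volume) (F := fun (j : ℤ) u => (f u : ℂ) * (extCoeff n σ r j * expi j (x - u)))
    (f := fun u => (f u : ℂ) * extKer n σ r (x - u)) (fun j _ => M * |extCoeff n σ r j|)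
    (fun j => by
      have : Measurable (expi j) := (continuous_expi j).measurable
      exact Measurable.aestronglyMeasurable (by fun_prop))
    (fun j => Filter.Eventually.of_forall fun u _ => by
      rw [norm_mul, norm_mul, norm_expi, mul_one, Complex.norm_real, Complex.norm_real]
      exact mul_le_mul_of_nonneg_right (hM u) (abs_nonneg _))
    (Filter.Eventually.of_forall fun u _ => hs.abs.mul_left M) (by simp)
    (Filter.Eventually.of_forall fun u _ => (hasSum_extKer n σ h0 h1 (x - u)).mul_left _)
  refine hasSum_of_eq h (fun j => ?_) rfl
  have e1 : (∫ u in (0 : ℝ)..1, (f u : ℂ) * (extCoeff n σ r j * expi j (x - u)))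
      = extCoeff n σ r j * expi j x * fc f j := by
    rw [fc, ← intervalIntegral.integral_const_mul]
    refine intervalIntegral.integral_congr fun u _ => ?_
    simp only [sub_eq_add_neg, expi_add, expi_neg]
    ring
  rw [e1]
  rcases lt_or_ge |j| (n : ℤ) with hj | hj
  · simp [hgap j hj]
  · rw [extCoeff_of_le hn hσ h0 h1 hj]
    push_cast
    ring

/-! ### Integration over the Poisson parameter -/

lemma integrable_of_hasSum {ι α : Type*} [Countable ι] [MeasurableSpace α] {μ : Measure α}
    {F : ι → α → ℂ} {G : α → ℂ} (hF : ∀ i, Integrable (F i) μ)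
    (hs : Summable fun i => ∫ a, ‖F i a‖ ∂μ) (hG : ∀ᵐ a ∂μ, HasSum (fun i => F i a) (G a)) :
    Integrable G μ := by
  refine ⟨aestronglyMeasurable_of_tendsto_ae Filter.atTop
    (f := fun (s : Finset ι) a => ∑ i ∈ s, F i a)
    (fun s => (integrable_finsetSum s fun i _ => hF i).1) hG, ?_⟩
  have h1 : ∫⁻ a, ‖G a‖ₑ ∂μ ≤ ∑' i, ∫⁻ a, ‖F i a‖ₑ ∂μ := by
    rw [← lintegral_tsum fun i => (hF i).1.enorm]
    refine lintegral_mono_ae ?_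
    filter_upwards [hG] with a ha
    rw [← ha.tsum_eq]
    exact enorm_tsum_le_tsum_enorm
  refine lt_of_le_of_lt h1 ?_
  have h2 : ∀ i, ∫⁻ a, ‖F i a‖ₑ ∂μ = ENNReal.ofReal (∫ a, ‖F i a‖ ∂μ) := fun i =>
    (ofReal_integral_norm_eq_lintegral_enorm (hF i)).symm
  simp only [h2]
  exact hs.tsum_ofReal_lt_top

/-- The weight `t ^ p / p!`, whose Laplace transform is `m ^ (-(p + 1))`. -/
def gammaWeight (p : ℕ) (t : ℝ) : ℝ := t ^ p / (p.factorial : ℝ)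

lemma gammaWeight_nonneg (p : ℕ) {t : ℝ} (ht : 0 ≤ t) : 0 ≤ gammaWeight p t := by
  unfold gammaWeight; positivity

lemma integral_gammaWeight (p : ℕ) {m : ℝ} (hm : 0 < m) :
    ∫ t in Set.Ioi (0 : ℝ), gammaWeight p t * Real.exp (-(m * t)) = 1 / m ^ (p + 1) := by
  have h1 := Real.integral_rpow_mul_exp_neg_mul_Ioi (a := (p : ℝ) + 1) (by positivity) hm
  rw [add_sub_cancel_right, Real.Gamma_nat_eq_factorial, ← Nat.cast_succ, Real.rpow_natCast] at h1
  simp only [Real.rpow_natCast] at h1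
  have h2 : ∀ t : ℝ, gammaWeight p t * Real.exp (-(m * t))
      = (t ^ p * Real.exp (-(m * t))) * (p.factorial : ℝ)⁻¹ := fun t => by
    unfold gammaWeight; ring
  simp only [h2]
  rw [integral_mul_const, h1, mul_assoc, mul_inv_cancel₀ (by positivity), mul_one, one_div_pow]

lemma integrable_gammaWeight (p : ℕ) {m : ℝ} (hm : 0 < m) :
    IntegrableOn (fun t => gammaWeight p t * Real.exp (-(m * t))) (Set.Ioi 0) := by
  refine Integrable.of_integral_ne_zero ?_
  rw [integral_gammaWeight p hm]
  positivity

lemma exp_neg_pow_natAbs (t : ℝ) (j : ℤ) :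
    Real.exp (-t) ^ j.natAbs = Real.exp (-(|(j : ℝ)| * t)) := by
  rw [← Real.exp_nat_mul, Nat.cast_natAbs, Int.cast_abs, mul_neg]

lemma sign_div_pow (p : ℕ) (j : ℤ) :
    (if 0 < j then 1 else (-1 : ℝ) ^ (p + 1)) * (1 / |(j : ℝ)| ^ (p + 1)) = 1 / (j : ℝ) ^ (p + 1) := by
  split_ifs with h
  · rw [abs_of_pos (by exact_mod_cast h), one_mul]
  · rw [abs_of_nonpos (by exact_mod_cast not_lt.1 h), ← one_div_pow, ← one_div_pow, ← mul_pow,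
      one_div_neg_eq_neg_one_div, neg_one_mul, neg_neg]

/-- Fourier multiplication by `j ^ (-(p + 1))`, as a superposition of convolutions with the
extremal kernels. -/
lemma gap_multiplier {n : ℕ} (hn : 0 < n) (p : ℕ) {f : ℝ → ℝ} {M : ℝ} (hf : Measurable f)
    (hM : ∀ u, |f u| ≤ M) (hgap : ∀ j : ℤ, |j| < n → fc f j = 0)
    (hs : Summable fun j : ℤ => fc f j / (j : ℂ) ^ (p + 1)) (x : ℝ) :
    IntegrableOn (fun t : ℝ => (gammaWeight p t : ℂ) *
      ∫ u in (0 : ℝ)..1, (f u : ℂ) * extKer n ((-1) ^ (p + 1)) (Real.exp (-t)) (x - u)) (Set.Ioi 0) ∧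
    HasSum (fun j : ℤ => fc f j / (j : ℂ) ^ (p + 1) * expi j x)
      (∫ t in Set.Ioi (0 : ℝ), (gammaWeight p t : ℂ) *
      ∫ u in (0 : ℝ)..1, (f u : ℂ) * extKer n ((-1) ^ (p + 1)) (Real.exp (-t)) (x - u)) := by
  have hσ : ((-1 : ℝ) ^ (p + 1)) ^ 2 = 1 := by rw [← pow_mul, mul_comm, pow_mul]; simp
  set σ : ℝ := (-1 : ℝ) ^ (p + 1) with hσdef
  have hf0 : fc f 0 = 0 := hgap 0 (by simpa using hn)
  let w : ℤ → ℝ := fun j => if 0 < j then 1 else σ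
  let F : ℤ → ℝ → ℂ := fun j t => (fc f j * w j * expi j x) *
    ((gammaWeight p t * Real.exp (-(|(j : ℝ)| * t)) : ℝ) : ℂ)
  have hw : ∀ j, |w j| = 1 := fun j => by
    simp only [w]
    split_ifs
    · simp
    · rwa [← sq_eq_sq₀ (abs_nonneg _) zero_le_one, sq_abs, one_pow]
  have hFint : ∀ j, Integrable (F j) (volume.restrict (Set.Ioi 0)) := fun j => by
    rcases eq_or_ne j 0 with rfl | hj
    · simp [F, hf0]
    · have hj' : 0 < |(j : ℝ)| := by positivity
      exact (Integrable.ofReal (integrable_gammaWeight p hj')).const_mul _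
  have hFnorm : ∀ j, ∫ t in Set.Ioi (0 : ℝ), ‖F j t‖ = ‖fc f j / (j : ℂ) ^ (p + 1)‖ := fun j => by
    rcases eq_or_ne j 0 with rfl | hj
    · simp [F, hf0]
    · have hj' : 0 < |(j : ℝ)| := by positivity
      have h1 : ∀ t ∈ Set.Ioi (0 : ℝ), ‖F j t‖
          = ‖fc f j‖ * (gammaWeight p t * Real.exp (-(|(j : ℝ)| * t))) := fun t ht => by
        simp only [F, norm_mul, norm_expi, Complex.norm_real, Real.norm_eq_abs, hw,
          abs_of_nonneg (gammaWeight_nonneg p (Set.mem_Ioi.1 ht).le), Real.abs_exp, mul_one]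
      rw [setIntegral_congr_fun measurableSet_Ioi h1, integral_const_mul,
        integral_gammaWeight p hj', norm_div, norm_pow, Complex.norm_intCast, mul_one_div]
  have hFval : ∀ j, ∫ t in Set.Ioi (0 : ℝ), F j t = fc f j / (j : ℂ) ^ (p + 1) * expi j x :=
      fun j => by
    rcases eq_or_ne j 0 with rfl | hj
    · simp [F, hf0]
    · have hj' : 0 < |(j : ℝ)| := by positivity
      have h2 := congrArg (fun y : ℝ => (y : ℂ)) (sign_div_pow p j)
      simp only [F]
      rw [integral_const_mul, integral_complex_ofReal, integral_gammaWeight p hj']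
      push_cast at h2 ⊢
      simp only [w, hσdef]
      linear_combination fc f j * expi j x * h2
  have hFsum : Summable fun j => ∫ t in Set.Ioi (0 : ℝ), ‖F j t‖ := by
    simp only [hFnorm]; exact hs.norm
  have hG : ∀ t ∈ Set.Ioi (0 : ℝ), HasSum (fun j => F j t) ((gammaWeight p t : ℂ) *
      ∫ u in (0 : ℝ)..1, (f u : ℂ) * extKer n σ (Real.exp (-t)) (x - u)) := fun t ht => by
    have h1 := (hasSum_integral_mul_extKer hn hσ (Real.exp_pos (-t)).le
      (Real.exp_lt_one_iff.2 (neg_lt_zero.2 ht)) hf hM hgap x).mul_left (gammaWeight p t : ℂ)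
    refine hasSum_of_eq h1 (fun j => ?_) rfl
    simp only [F, w, ← exp_neg_pow_natAbs]
    push_cast
    ring
  have hG' : ∀ᵐ t ∂(volume.restrict (Set.Ioi (0 : ℝ))), HasSum (fun j => F j t)
      ((gammaWeight p t : ℂ) *
      ∫ u in (0 : ℝ)..1, (f u : ℂ) * extKer n σ (Real.exp (-t)) (x - u)) :=
    (ae_restrict_iff' measurableSet_Ioi).2 (Filter.Eventually.of_forall hG)
  refine ⟨integrable_of_hasSum hFint hFsum hG', ?_⟩
  refine hasSum_of_eq (hasSum_integral_of_summable_integral_norm hFint hFsum)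
    (fun j => (hFval j).symm) ?_
  exact integral_congr_ae (hG'.mono fun t ht => ht.tsum_eq.symm)

lemma intervalIntegrable_mul_expi {f : ℝ → ℝ} {M : ℝ} (hf : Measurable f) (hM : ∀ u, |f u| ≤ M)
    (q : ℤ) (a b : ℝ) : IntervalIntegrable (fun u => (f u : ℂ) * expi q u) volume a b := by
  have he : Measurable (expi q) := (continuous_expi _).measurable
  refine (intervalIntegrable_const (c := M)).mono_fun
    (Measurable.aestronglyMeasurable (by fun_prop)) (Filter.Eventually.of_forall fun u => ?_)
  simp only [norm_mul, norm_expi, mul_one, Complex.norm_real, Real.norm_eq_abs]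
  exact (hM u).trans (le_abs_self M)

/-! ### The square wave -/

/-- The square wave `sign (sin (2πt))`, with value `1` at the zeros. -/
def squareWave (t : ℝ) : ℝ := if Real.sin (2 * π * t) < 0 then -1 else 1

lemma squareWave_mul_sin (t : ℝ) :
    squareWave t * Real.sin (2 * π * t) = |Real.sin (2 * π * t)| := by
  unfold squareWave
  split_ifs with h
  · rw [abs_of_neg h, neg_one_mul]
  · rw [abs_of_nonneg (not_lt.1 h), one_mul]

lemma abs_squareWave (t : ℝ) : |squareWave t| = 1 := by
  unfold squareWave; split_ifs <;> simp

lemma measurable_squareWave : Measurable squareWave :=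
  Measurable.ite (measurableSet_lt (by fun_prop) measurable_const) measurable_const
    measurable_const

lemma squareWave_periodic : Function.Periodic squareWave 1 := fun t => by
  simp only [squareWave, mul_add, mul_one, Real.sin_add_two_pi]

lemma expi_even_half (l : ℤ) : expi (2 * l) (1 / 2) = 1 := by
  rw [expi_mul]; norm_num [expi_one_right]

lemma expi_odd_half (l : ℤ) : expi (2 * l + 1) (1 / 2) = -1 := by
  rw [expi_add_index, expi_even_half, one_mul, expi, ← Complex.exp_pi_mul_I]
  congr 1; push_cast; ring

lemma integral_expi {q : ℤ} (hq : q ≠ 0) (a b : ℝ) :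
    ∫ u in a..b, expi q u = (expi q b - expi q a) / (2 * π * Complex.I * q) := by
  have hq' : (2 * π * Complex.I * q : ℂ) ≠ 0 := by
    simp [Real.pi_ne_zero, Complex.I_ne_zero, hq]
  rw [eq_div_iff hq', mul_comm, ← intervalIntegral.integral_const_mul]
  exact intervalIntegral.integral_eq_sub_of_hasDerivAt (fun x _ => hasDerivAt_expi q x)
    (Continuous.intervalIntegrable (by fun_prop) _ _)

lemma fc_squareWave (q : ℤ) :
    fc squareWave q = (∫ u in (0 : ℝ)..(1 / 2), expi (-q) u) - ∫ u in (1 / 2 : ℝ)..1, expi (-q) u := by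
  have e1 : Set.EqOn (fun u => (squareWave u : ℂ) * expi (-q) u) (expi (-q))
      (Set.Ioo 0 (1 / 2)) := fun u hu => by
    have : ¬ Real.sin (2 * π * u) < 0 := not_lt.2 <| Real.sin_nonneg_of_nonneg_of_le_pi
      (by have := hu.1; positivity) (by nlinarith [hu.2, Real.pi_pos])
    simp [squareWave, this]
  have e2 : Set.EqOn (fun u => (squareWave u : ℂ) * expi (-q) u) (fun u => -expi (-q) u)
      (Set.Ioo (1 / 2) 1) := fun u hu => by
    have h1 : Real.sin (2 * π * u - 2 * π) < 0 := Real.sin_neg_of_neg_of_neg_pi_lt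
      (by nlinarith [hu.2, Real.pi_pos]) (by nlinarith [hu.1, Real.pi_pos])
    rw [Real.sin_sub_two_pi] at h1
    simp [squareWave, h1]
  have hi := intervalIntegrable_mul_expi measurable_squareWave (fun u => (abs_squareWave u).le) (-q)
  rw [fc, ← intervalIntegral.integral_add_adjacent_intervals (hi 0 (1 / 2)) (hi (1 / 2) 1),
    intervalIntegral.integral_congr_Ioo_of_le (by norm_num) e1,
    intervalIntegral.integral_congr_Ioo_of_le (by norm_num) e2, intervalIntegral.integral_neg,
    sub_eq_add_neg]

lemma fc_squareWave_even (l : ℤ) : fc squareWave (2 * l) = 0 := by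
  rw [fc_squareWave]
  rcases eq_or_ne l 0 with rfl | hl
  · norm_num
  · rw [integral_expi (by omega), integral_expi (by omega), expi_one_right, expi_zero_right,
      ← mul_neg, expi_even_half]
    simp

lemma fc_squareWave_odd (l : ℤ) :
    fc squareWave (2 * l + 1) = 2 / (π * Complex.I * ((2 * l + 1 : ℤ) : ℂ)) := by
  have h0 : ((2 * l + 1 : ℤ) : ℂ) ≠ 0 := by exact_mod_cast (by omega : (2 * l + 1 : ℤ) ≠ 0)
  have hpi : (π : ℂ) ≠ 0 := by exact_mod_cast Real.pi_ne_zero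
  rw [fc_squareWave, integral_expi (by omega), integral_expi (by omega), expi_one_right,
    expi_zero_right, show -(2 * l + 1) = 2 * (-l - 1) + 1 by ring, expi_odd_half,
    show 2 * (-l - 1) + 1 = -(2 * l + 1) by ring]
  rw [Int.cast_neg]
  field_simp
  ring

/-! ### Dilations -/

lemma fc_dilate_mul {n : ℕ} (hn : 0 < n) {f : ℝ → ℝ} {M : ℝ} (hf : Measurable f)
    (hM : ∀ u, |f u| ≤ M) (hp : Function.Periodic f 1) (β : ℝ) (q : ℤ) :
    fc (fun u => f (n * u + β)) (n * q) = expi q β * fc f q := by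
  have hn' : (n : ℝ) ≠ 0 := by positivity
  let G : ℝ → ℂ := fun v => (f v : ℂ) * expi (-q) (v - β)
  have hG : Function.Periodic G 1 := fun v => by
    simp only [G, hp v, add_sub_right_comm v 1 β, expi_periodic _ (v - β)]
  have h1 : fc (fun u => f (n * u + β)) (n * q) = ∫ u in (0 : ℝ)..1, G (n * u + β) := by
    refine intervalIntegral.integral_congr fun u _ => ?_
    simp only [G, add_sub_cancel_right, ← mul_neg, expi_mul, Int.cast_natCast]
  have h3 : ∀ v, G v = expi q β * ((f v : ℂ) * expi (-q) v) := fun v => by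
    simp only [G, sub_eq_add_neg, expi_add, expi_neg, neg_neg]; ring
  have h2 := hG.intervalIntegral_add_zsmul_eq n β fun a b => by
    rw [funext h3]
    exact (intervalIntegrable_mul_expi hf hM _ a b).const_mul _
  rw [h1, intervalIntegral.integral_comp_mul_add _ hn', mul_zero, zero_add, mul_one, add_comm]
  simp only [zsmul_eq_mul, Int.cast_natCast, mul_one] at h2
  rw [h2, hG.intervalIntegral_add_eq β 0, zero_add, funext h3, intervalIntegral.integral_const_mul,
    ← fc, Complex.real_smul, ← mul_assoc]
  push_cast
  rw [inv_mul_cancel₀ (by exact_mod_cast hn'), one_mul]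

lemma fc_dilate_of_not_dvd {n : ℕ} (hn : 0 < n) {f : ℝ → ℝ} (hp : Function.Periodic f 1) (β : ℝ)
    {j : ℤ} (hj : ¬ (n : ℤ) ∣ j) : fc (fun u => f (n * u + β)) j = 0 := by
  have hn' : (n : ℝ) ≠ 0 := by positivity
  let G : ℝ → ℂ := fun u => (f (n * u + β) : ℂ) * expi (-j) u
  have hpn : ∀ v, f (v + n) = f v := fun v => by simpa using hp.nat_mul n v
  have hG : Function.Periodic G 1 := fun u => by
    simp only [G, expi_periodic _ u, mul_add, mul_one, add_right_comm _ (n : ℝ) β, hpn]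
  have h1 : ∀ u, G (u + 1 / n) = expi (-j) (1 / n) * G u := fun u => by
    simp only [G, expi_add, mul_add, mul_one_div_cancel hn', add_right_comm _ (1 : ℝ) β, hp _]
    ring
  have h2 := hG.intervalIntegral_add_eq (1 / n : ℝ) 0
  have h3 := intervalIntegral.integral_comp_add_right (a := 0) (b := 1) G (1 / n : ℝ)
  simp only [h1, zero_add] at h2 h3
  rw [intervalIntegral.integral_const_mul, add_comm (1 : ℝ), h2] at h3
  have h4 : expi (-j) (1 / n) ≠ 1 := by
    rw [expi, Ne, Complex.exp_eq_one_iff]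
    rintro ⟨m, hm⟩
    apply hj
    refine ⟨-m, ?_⟩
    have hc : (n : ℂ) ≠ 0 := by exact_mod_cast hn'
    have hI : (2 * π * Complex.I : ℂ) ≠ 0 := Complex.two_pi_I_ne_zero
    have h5 : (2 * π * Complex.I : ℂ) * (j + n * m) = 0 := by
      push_cast at hm
      field_simp at hm
      linear_combination (-2 * π * Complex.I : ℂ) * hm
    have h6 : (j : ℂ) + n * m = 0 := (mul_eq_zero.1 h5).resolve_left hI
    have h7 : j + n * m = 0 := by exact_mod_cast h6
    linarith
  change ∫ u in (0 : ℝ)..1, G u = 0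
  have h8 : (expi (-j) (1 / n) - 1) * (∫ u in (0 : ℝ)..1, G u) = 0 := by
    rw [sub_mul, one_mul, h3, sub_self]
  exact (mul_eq_zero.1 h8).resolve_left (sub_ne_zero.2 h4)

/-! ### The extremal square wave -/

lemma exists_phase (p : ℕ) : ∃ (a : ℂ) (β : ℝ), a * expi 1 β = Complex.I ∧
    a * expi (-1) β = -(-1) ^ (p + 1) * Complex.I ∧ ∀ j : ℤ, expi (4 * j) β = 1 := by
  rcases Nat.even_or_odd (p + 1) with hp | hp
  · have h1 : expi 1 (1 / 4) = Complex.I := by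
      rw [expi, show 2 * (π : ℂ) * Complex.I * (1 : ℤ) * ((1 / 4 : ℝ) : ℂ) = π / 2 * Complex.I by
        push_cast; ring, Complex.exp_pi_div_two_mul_I]
    refine ⟨1, 1 / 4, by rw [h1, one_mul], ?_, fun j => ?_⟩
    · rw [← conj_expi, h1, hp.neg_one_pow, Complex.conj_I]; ring
    · rw [expi_mul]; norm_num [expi_one_right]
  · refine ⟨Complex.I, 0, by simp, ?_, by simp⟩
    rw [hp.neg_one_pow]; simp

section SquareWave

variable {n p : ℕ} {a : ℂ} {β : ℝ}

lemma phase_mul_extKer (hn : 0 < n) {σ : ℝ} (hσ : σ ^ 2 = 1) (h1 : a * expi 1 β = Complex.I)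
    (h2 : a * expi (-1) β = -σ * Complex.I) {r : ℝ} (hr0 : 0 ≤ r) (hr1 : r < 1) (u : ℝ) :
    a * ((squareWave (n * u + β) : ℂ) * extKer n σ r (-u)) = (‖extKer n σ r (-u)‖ : ℝ) := by
  set w : ℝ := n * u + β with hw
  have hσ' : (σ : ℂ) ^ 2 = 1 := by exact_mod_cast hσ
  have ha : ‖a‖ = 1 := by simpa [norm_expi] using congrArg norm h1
  obtain ⟨c, hc0, hc⟩ : ∃ c : ℝ, 0 ≤ c ∧
      extKer n σ r (-u) = c * (expi n (-u) + σ * expi (-n) (-u)) := by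
    refine ⟨r ^ n * pois r (-u) / (1 + σ * r ^ (2 * n)), ?_, ?_⟩
    · have := pois_nonneg hr0 hr1 (-u)
      have := one_add_pos hn hσ hr0 hr1
      positivity
    · unfold extKer; push_cast; ring
  have e1 : expi n (-u) = expi (-1) w * expi 1 β := by
    rw [hw, expi_add, mul_assoc, mul_comm (expi (-1) β), expi_mul_neg, mul_one, expi_neg,
      ← mul_neg_one, expi_mul, Int.cast_natCast]
  have e2 : expi (-n) (-u) = expi 1 w * expi (-1) β := by
    rw [hw, expi_add, mul_assoc, expi_mul_neg, mul_one, expi_neg, neg_neg,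
      ← mul_one (n : ℤ), expi_mul, Int.cast_natCast]
  have e3 : Complex.I * (expi (-1) w - expi 1 w) = ((2 * Real.sin (2 * π * w) : ℝ) : ℂ) := by
    simp only [expi]
    push_cast
    rw [Complex.sin]
    ring_nf
  have e4 : a * extKer n σ r (-u) = ((c * (2 * Real.sin (2 * π * w)) : ℝ) : ℂ) := by
    rw [hc, e1, e2, Complex.ofReal_mul, ← e3]
    linear_combination (c : ℂ) * expi (-1) w * h1 + c * expi 1 w * σ * h2
      - c * expi 1 w * Complex.I * hσ'
  have e5 : ‖extKer n σ r (-u)‖ = c * (2 * |Real.sin (2 * π * w)|) := by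
    have := congrArg norm e4
    rwa [norm_mul, ha, one_mul, Complex.norm_real, Real.norm_eq_abs, abs_mul, abs_mul,
      abs_of_nonneg hc0, abs_two] at this
  rw [e5, ← squareWave_mul_sin, mul_left_comm, e4]
  push_cast
  ring

lemma summable_favard (p : ℕ) : Summable fun j : ℤ => 1 / (4 * (j : ℝ) + 1) ^ (p + 1 + 1) := by
  have h1 := (Real.summable_one_div_int_pow (p := p + 1 + 1)).2 (by omega)
  have h2 : Function.Injective fun j : ℤ => 4 * j + 1 := fun i j h => by
    simp only at h; omega
  simpa [Function.comp_def] using h1.comp_injective h2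

lemma fc_dilate_squareWave_odd (hn : 0 < n) (l : ℤ) :
    fc (fun u => squareWave (n * u + β)) (n * (2 * l + 1)) =
      expi (2 * l + 1) β * (2 / (π * Complex.I * ((2 * l + 1 : ℤ) : ℂ))) := by
  rw [fc_dilate_mul hn measurable_squareWave (fun u => (abs_squareWave u).le) squareWave_periodic,
    fc_squareWave_odd]

lemma fc_dilate_squareWave_eq_zero (hn : 0 < n) {j : ℤ}
    (hj : ∀ l : ℤ, j ≠ n * (2 * l + 1)) : fc (fun u => squareWave (n * u + β)) j = 0 := by
  by_cases hd : (n : ℤ) ∣ j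
  · obtain ⟨q, rfl⟩ := hd
    rcases Int.even_or_odd' q with ⟨l, rfl | rfl⟩
    · rw [fc_dilate_mul hn measurable_squareWave (fun u => (abs_squareWave u).le)
        squareWave_periodic, fc_squareWave_even, mul_zero]
    · exact absurd rfl (hj l)
  · exact fc_dilate_of_not_dvd hn squareWave_periodic β hd

lemma hasSum_dilate_squareWave (hn : 0 < n) (h1 : a * expi 1 β = Complex.I)
    (h2 : a * expi (-1) β = -(-1) ^ (p + 1) * Complex.I) (h4 : ∀ j : ℤ, expi (4 * j) β = 1) :
    HasSum (fun j : ℤ => a * (fc (fun u => squareWave (n * u + β)) j / (j : ℂ) ^ (p + 1)))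
      ((favard (p + 1) / n ^ (p + 1) : ℝ) : ℂ) := by
  have hnC : (n : ℂ) ≠ 0 := by exact_mod_cast hn.ne'
  have hpi : (π : ℂ) ≠ 0 := by exact_mod_cast Real.pi_ne_zero
  have hnZ : (n : ℤ) ≠ 0 := by exact_mod_cast hn.ne'
  set F : ℤ → ℂ :=
    fun j => a * (fc (fun u => squareWave (n * u + β)) j / (j : ℂ) ^ (p + 1)) with hF
  let i₁ : ℤ → ℤ := fun l => n * (4 * l + 1)
  let i₂ : ℤ → ℤ := fun l => n * (-(4 * l + 1))
  have hi₁ : Function.Injective i₁ := fun x y h => by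
    have := mul_left_cancel₀ hnZ h; omega
  have hi₂ : Function.Injective i₂ := fun x y h => by
    have := mul_left_cancel₀ hnZ h; omega
  have hS : HasSum (fun l : ℤ => (2 / (π * n ^ (p + 1)) : ℂ) *
      ((1 / (4 * (l : ℝ) + 1) ^ (p + 1 + 1) : ℝ) : ℂ)) ((favard (p + 1) / n ^ (p + 1) / 2 : ℝ) : ℂ) := by
    refine hasSum_of_eq ((Complex.hasSum_ofReal.2 (summable_favard p).hasSum).mul_left
      (2 / (π * n ^ (p + 1)) : ℂ)) (fun _ => rfl) ?_
    rw [favard]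
    push_cast
    field_simp
    ring
  have hq : ∀ l : ℤ, (4 * (l : ℂ) + 1) ≠ 0 := fun l => by
    exact_mod_cast (by omega : (4 * l + 1 : ℤ) ≠ 0)
  have H₁ : HasSum (F ∘ i₁) ((favard (p + 1) / n ^ (p + 1) / 2 : ℝ) : ℂ) := by
    refine hasSum_of_eq hS (fun l => ?_) rfl
    have hql := hq l
    simp only [Function.comp, hF, i₁]
    rw [show 4 * l + 1 = 2 * (2 * l) + 1 by ring, fc_dilate_squareWave_odd hn,
      show 2 * (2 * l) + 1 = 4 * l + 1 by ring, expi_add_index, h4, one_mul]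
    push_cast
    rw [mul_div_assoc, ← mul_assoc, h1, mul_pow]
    field_simp
    ring
  have H₂ : HasSum (F ∘ i₂) ((favard (p + 1) / n ^ (p + 1) / 2 : ℝ) : ℂ) := by
    refine hasSum_of_eq hS (fun l => ?_) rfl
    have hql := hq l
    simp only [Function.comp, hF, i₂]
    rw [show -(4 * l + 1) = 2 * (-(2 * l) - 1) + 1 by ring, fc_dilate_squareWave_odd hn,
      show 2 * (-(2 * l) - 1) + 1 = 4 * (-l) + (-1) by ring, expi_add_index, h4, one_mul,
      show 4 * (-l) + (-1) = -(4 * l + 1) by ring]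
    push_cast
    rw [mul_div_assoc, ← mul_assoc, h2, mul_pow, neg_pow (4 * (l : ℂ) + 1)]
    have hm : ((-1 : ℂ) ^ (p + 1)) ≠ 0 := by simp
    field_simp
    ring
  have hd : Disjoint (Set.range i₁) (Set.range i₂) := by
    rw [Set.disjoint_left]
    rintro _ ⟨x, rfl⟩ ⟨y, h⟩
    have := mul_left_cancel₀ hnZ h
    omega
  have hsupp : Function.support F ⊆ Set.range i₁ ∪ Set.range i₂ := by
    intro j hj
    by_contra hc
    apply hj
    simp only [hF]
    rw [fc_dilate_squareWave_eq_zero hn, zero_div, mul_zero]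
    rintro l rfl
    apply hc
    rcases Int.even_or_odd' l with ⟨m, rfl | rfl⟩
    · exact Or.inl ⟨m, by simp only [i₁]; ring⟩
    · exact Or.inr ⟨-m - 1, by simp only [i₂]; ring⟩
  have H := HasSum.add_disjoint (f := F) hd (hi₁.hasSum_range_iff.2 H₁) (hi₂.hasSum_range_iff.2 H₂)
  refine hasSum_of_eq ((hasSum_subtype_iff_of_support_subset hsupp).1 H) (fun _ => rfl) ?_
  push_cast
  ring

/-- The weighted `L¹` norm of the extremal kernels is the Favard constant. -/
lemma integral_norm_extKer (hn : 0 < n) (p : ℕ) :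
    IntegrableOn (fun t : ℝ => gammaWeight p t *
      ∫ u in (0 : ℝ)..1, ‖extKer n ((-1) ^ (p + 1)) (Real.exp (-t)) (-u)‖) (Set.Ioi 0) ∧
    ∫ t in Set.Ioi (0 : ℝ), gammaWeight p t *
      ∫ u in (0 : ℝ)..1, ‖extKer n ((-1) ^ (p + 1)) (Real.exp (-t)) (-u)‖ =
        favard (p + 1) / n ^ (p + 1) := by
  obtain ⟨a, β, h1, h2, h4⟩ := exists_phase p
  have hσ : ((-1 : ℝ) ^ (p + 1)) ^ 2 = 1 := by rw [← pow_mul, mul_comm, pow_mul]; simp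
  have ha : a ≠ 0 := by rintro rfl; exact Complex.I_ne_zero (by rw [← h1, zero_mul])
  have hsum := hasSum_dilate_squareWave hn h1 h2 h4
  have hgap : ∀ j : ℤ, |j| < n → fc (fun u => squareWave (n * u + β)) j = 0 := fun j hj =>
    fc_dilate_squareWave_eq_zero hn fun l hl => by
      rw [hl, abs_mul, Nat.abs_cast] at hj
      have : 1 ≤ |2 * l + 1| := Int.one_le_abs (by omega)
      nlinarith
  have hmeas : Measurable fun u => squareWave (n * u + β) :=
    measurable_squareWave.comp (by fun_prop)
  obtain ⟨hint, hval⟩ := gap_multiplier hn p hmeas (fun u => (abs_squareWave _).le) hgap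
    ((summable_mul_left_iff ha).1 hsum.summable) 0
  have key : ∀ t ∈ Set.Ioi (0 : ℝ), a * ((gammaWeight p t : ℂ) * ∫ u in (0 : ℝ)..1,
      (squareWave (n * u + β) : ℂ) * extKer n ((-1) ^ (p + 1)) (Real.exp (-t)) (0 - u)) =
      ((gammaWeight p t * ∫ u in (0 : ℝ)..1,
        ‖extKer n ((-1) ^ (p + 1)) (Real.exp (-t)) (-u)‖ : ℝ) : ℂ) := fun t ht => by
    rw [mul_left_comm, ← intervalIntegral.integral_const_mul, Complex.ofReal_mul,
      ← intervalIntegral.integral_ofReal]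
    congr 1
    refine intervalIntegral.integral_congr fun u _ => ?_
    simp only [zero_sub]
    exact phase_mul_extKer hn hσ h1 (by push_cast; exact h2) (Real.exp_pos _).le
      (Real.exp_lt_one_iff.2 (neg_lt_zero.2 ht)) u
  constructor
  · have := (integrableOn_congr_fun key measurableSet_Ioi).1 (hint.const_mul a)
    simpa [IntegrableOn] using this.re
  · have h5 := (hval.mul_left a).unique (hasSum_of_eq hsum (fun j => by simp) rfl)
    rw [← integral_const_mul, setIntegral_congr_fun measurableSet_Ioi key,
      integral_complex_ofReal] at h5
    exact_mod_cast h5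

/-- The sharp bound for the Fourier multiplier `j ^ (-(p + 1))` on functions without
frequencies below `n`. -/
lemma norm_hasSum_le (hn : 0 < n) {f : ℝ → ℝ} {M : ℝ} (hf : Measurable f) (hM : ∀ u, |f u| ≤ M)
    (hgap : ∀ j : ℤ, |j| < n → fc f j = 0)
    (hs : Summable fun j : ℤ => fc f j / (j : ℂ) ^ (p + 1)) {x : ℝ} {S : ℂ}
    (hS : HasSum (fun j : ℤ => fc f j / (j : ℂ) ^ (p + 1) * expi j x) S) :
    ‖S‖ ≤ M * (favard (p + 1) / n ^ (p + 1)) := by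
  obtain ⟨hint, hval⟩ := integral_norm_extKer hn p
  rw [hS.unique (gap_multiplier hn p hf hM hgap hs x).2, ← hval, ← integral_const_mul]
  refine norm_integral_le_of_norm_le (hint.const_mul M) ?_
  refine (ae_restrict_iff' measurableSet_Ioi).2 (Filter.Eventually.of_forall fun t ht => ?_)
  set K := extKer n ((-1) ^ (p + 1)) (Real.exp (-t)) with hK
  have hKc : Continuous K := continuous_extKer n _ (Real.exp_pos _).le
    (Real.exp_lt_one_iff.2 (neg_lt_zero.2 ht))
  have hKp : Function.Periodic (fun u => ‖K u‖) 1 := fun u => by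
    simp only [hK, extKer_periodic n _ _ u]
  have h1 : ∫ u in (0 : ℝ)..1, ‖K (x - u)‖ = ∫ u in (0 : ℝ)..1, ‖K (-u)‖ := by
    rw [intervalIntegral.integral_comp_sub_left (fun u => ‖K u‖),
      intervalIntegral.integral_comp_neg (fun u => ‖K u‖)]
    simpa using hKp.intervalIntegral_add_eq (x - 1) (-1)
  have h2 : ‖∫ u in (0 : ℝ)..1, (f u : ℂ) * K (x - u)‖ ≤ ∫ u in (0 : ℝ)..1, M * ‖K (x - u)‖ := by
    refine intervalIntegral.norm_integral_le_of_norm_le zero_le_one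
      (Filter.Eventually.of_forall fun u _ => ?_)
      (Continuous.intervalIntegrable (by fun_prop) _ _)
    rw [norm_mul, Complex.norm_real]
    exact mul_le_mul_of_nonneg_right (hM u) (norm_nonneg _)
  rw [intervalIntegral.integral_const_mul, h1] at h2
  have h3 := gammaWeight_nonneg p (Set.mem_Ioi.1 ht).le
  rw [norm_mul, Complex.norm_real, Real.norm_of_nonneg h3, mul_left_comm]
  exact mul_le_mul_of_nonneg_left h2 h3

lemma abs_iterate_meanPrim_le (hn : 0 < n) {g : ℝ → ℝ} {M : ℝ} (hg : Continuous g)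
    (hper : Function.Periodic g 1) (hM : ∀ u, |g u| ≤ M)
    (hgap : ∀ j : ℤ, |j| < n → fc g j = 0) (x : ℝ) :
    |(meanPrim^[p + 1] g) x| ≤ M * (favard (p + 1) / n ^ (p + 1)) / (2 * π) ^ (p + 1) := by
  have h0 : ∫ u in (0 : ℝ)..1, g u = 0 := by
    have := hgap 0 (by simpa using hn)
    rw [fc_zero] at this
    exact_mod_cast this
  obtain ⟨hc, hp, -, hfc⟩ := iterate_meanPrim hg hper h0 (p + 1)
  have hs := summable_fc_div_pow hg hper p
  have hc0 : ((2 * π * Complex.I : ℂ) ^ (p + 1)) ≠ 0 := pow_ne_zero _ Complex.two_pi_I_ne_zero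
  have e1 : ∀ j : ℤ, fc (meanPrim^[p + 1] g) j =
      (fc g j / (j : ℂ) ^ (p + 1)) / (2 * π * Complex.I) ^ (p + 1) := fun j => by
    rw [hfc, mul_pow, div_div, mul_comm ((j : ℂ) ^ _)]
  have h1 := hasSum_fc hc hp (by rw [funext e1]; exact hs.div_const _) x
  have h2 := norm_hasSum_le hn hg.measurable hM hgap hs (x := x)
    (hasSum_of_eq (h1.mul_left ((2 * π * Complex.I : ℂ) ^ (p + 1)))
      (fun j => by rw [e1]; field_simp) rfl)
  rw [norm_mul, norm_pow, norm_mul, Complex.norm_I, mul_one, Complex.norm_real, norm_mul,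
    Complex.norm_real, Real.norm_of_nonneg Real.pi_pos.le, Complex.norm_two, Real.norm_eq_abs] at h2
  rw [le_div_iff₀ (by positivity), mul_comm]
  exact h2

end SquareWave

theorem conv_bound_orthogonal (k n : ℕ) (hk : 0 < k) (hn : 0 < n)
    (h : ℝ) (hh : 0 < h) (hkh : (k : ℝ) * h ≤ 1)
    (g : ℝ → ℝ) (hg : Continuous g) (hper : Function.Periodic g 1)
    (horth : ∀ j : ℤ, |j| ≤ (n : ℤ) - 1 →
      (∫ u in (0:ℝ)..1, (g u : ℂ) *
        Complex.exp (-(2 * (Real.pi : ℂ) * Complex.I * (j : ℂ) * (u : ℂ)))) = 0) :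
    ∀ x : ℝ, |pconv g (chiK h k) x|
      ≤ favard k / (π * n * h) ^ k * ⨆ y : ℝ, |g y| := by
  intro x
  obtain ⟨p, rfl⟩ : ∃ p, k = p + 1 := ⟨k - 1, by omega⟩
  have hle : h ≤ 1 := by
    push_cast at hkh
    nlinarith [mul_nonneg p.cast_nonneg hh.le]
  obtain ⟨B, hB⟩ := exists_abs_le_of_periodic hg hper
  have hM : ∀ u, |g u| ≤ ⨆ y : ℝ, |g y| :=
    fun u => le_ciSup (f := fun y => |g y|) ⟨B, by rintro _ ⟨y, rfl⟩; exact hB y⟩ u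
  have hgap : ∀ j : ℤ, |j| < n → fc g j = 0 := fun j hj => by
    rw [← horth j (by omega)]
    refine intervalIntegral.integral_congr fun u _ => ?_
    simp only [expi]
    congr 2
    push_cast
    ring
  have h0 : ∫ u in (0 : ℝ)..1, g u = 0 := by
    have := hgap 0 (by simpa using hn)
    rw [fc_zero] at this
    exact_mod_cast this
  have hQ := iterate_meanPrim hg hper h0
  refine (abs_pconv_chiK_le hh hle p (fun m => meanPrim^[m] g) _ (fun m => (hQ m).1)
    (fun m => (hQ m).2.1) (fun m y => ?_)
    (abs_iterate_meanPrim_le hn hg hper hM hgap) x).trans_eq ?_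
  · rw [Function.iterate_succ_apply']
    exact hasDerivAt_meanPrim (hQ m).1 y
  · have hpi := Real.pi_ne_zero
    rw [div_pow, mul_pow, mul_pow, mul_pow]
    field_simp
end
end

section
/- Let k be an odd positive integer and j a nonnegative integer. Then ∫_ℝ χ_{2j+1}^k(u) · (−1)^j · sign(cos(π u)) du = F_k · (2j+1)^{−k}, where χ_{2j+1}^k is the k-fold convolution over ℝ of the function χ_{2j+1} with itself, F_k = (2/π)^k 𝒦_k, and 𝒦_k = (4/π) Σ_{m∈ℤ} (4m+1)^{−(k+1)}. -/
open Real MeasureTheory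

noncomputable section
open scoped Classical

/-- The normalized indicator `χ_a : ℝ → ℝ`, equal to `a⁻¹` on `(-a/2, a/2)`
and `0` elsewhere. -/
def chiR (a : ℝ) (x : ℝ) : ℝ := if |x| < a / 2 then a⁻¹ else 0

/-- Convolution over `ℝ`: `(f*g)(x) = ∫_ℝ f(u) g(x-u) du`. -/
def rconv (f g : ℝ → ℝ) (x : ℝ) : ℝ := ∫ u, f u * g (x - u)

/-- The `k`-fold self-convolution of `χ_a` over `ℝ`: `χ_a^1 = χ_a`,
`χ_a^{k+1} = χ_a * χ_a^k`. -/
def chiRK (a : ℝ) : ℕ → ℝ → ℝ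
  | 0 => fun _ => 0
  | 1 => chiR a
  | (k + 2) => rconv (chiR a) (chiRK a (k + 1))

/-! ### Convolution powers of the normalized indicator -/

theorem chiR_eq_indicator (a : ℝ) :
    chiR a = (Set.Ioo (-(a / 2)) (a / 2)).indicator fun _ => a⁻¹ := by
  funext x
  simp [chiR, Set.indicator_apply, abs_lt]

theorem integrable_chiR (a : ℝ) : Integrable (chiR a) := by
  rw [chiR_eq_indicator, integrable_indicator_iff measurableSet_Ioo]
  exact integrableOn_const measure_Ioo_lt_top.ne

theorem integrable_rconv {f g : ℝ → ℝ} (hf : Integrable f) (hg : Integrable g) :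
    Integrable (rconv f g) :=
  hf.integrable_convolution (ContinuousLinearMap.mul ℝ ℝ) hg

theorem integrable_chiRK (a : ℝ) (k : ℕ) : Integrable (chiRK a (k + 1)) := by
  induction k with
  | zero => exact integrable_chiR a
  | succ k ih => exact integrable_rconv (integrable_chiR a) ih

/-- Testing a convolution against a bounded function. -/
theorem integral_rconv_mul {f g h : ℝ → ℝ} (hf : Integrable f) (hg : Integrable g)
    (hh : Measurable h) {C : ℝ} (hC : ∀ x, |h x| ≤ C) :
    ∫ u, rconv f g u * h u = ∫ w, g w * ∫ v, f v * h (w + v) := by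
  have h₁ : Integrable (fun p : ℝ × ℝ => f p.2 * g (p.1 - p.2) * h p.1)
      (volume.prod volume) :=
    (hf.convolution_integrand (ContinuousLinearMap.mul ℝ ℝ) hg).mul_bdd
      (hh.comp measurable_fst).aestronglyMeasurable
      (Filter.Eventually.of_forall fun p => hC p.1)
  have h₂ : Integrable (fun p : ℝ × ℝ => f p.1 * g p.2 * h (p.2 + p.1))
      (volume.prod volume) :=
    (hf.mul_prod hg).mul_bdd
      (hh.comp (measurable_snd.add measurable_fst)).aestronglyMeasurable
      (Filter.Eventually.of_forall fun p => hC _)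
  calc ∫ u, rconv f g u * h u
      = ∫ u, ∫ v, f v * g (u - v) * h u := by
        refine integral_congr_ae (Filter.Eventually.of_forall fun u => ?_)
        exact (integral_mul_const (h u) fun v => f v * g (u - v)).symm
    _ = ∫ v, ∫ u, f v * g (u - v) * h u := integral_integral_swap h₁
    _ = ∫ v, ∫ w, f v * g w * h (w + v) := by
        refine integral_congr_ae (Filter.Eventually.of_forall fun v => ?_)
        have := integral_sub_right_eq_self (fun w => f v * g w * h (w + v)) (μ := volume) v
        simpa using this
    _ = ∫ w, ∫ v, f v * g w * h (w + v) := integral_integral_swap h₂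
    _ = ∫ w, g w * ∫ v, f v * h (w + v) := by
        refine integral_congr_ae (Filter.Eventually.of_forall fun w => ?_)
        dsimp only
        rw [← integral_const_mul]
        congr 1
        funext v
        ring

theorem integral_chiR_mul_comp_add {a : ℝ} (ha : 0 < a) (h : ℝ → ℝ) (w : ℝ) :
    ∫ v, chiR a v * h (w + v) = a⁻¹ * ∫ u in (w - a / 2)..(w + a / 2), h u := by
  have e : (fun v => chiR a v * h (w + v)) =
      (Set.Ioo (-(a / 2)) (a / 2)).indicator fun v => a⁻¹ * h (w + v) := by
    funext v
    rw [chiR_eq_indicator]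
    by_cases hv : v ∈ Set.Ioo (-(a / 2)) (a / 2) <;> simp [hv]
  rw [e, integral_indicator measurableSet_Ioo, integral_const_mul,
    ← setIntegral_congr_set Ioo_ae_eq_Ioc.symm,
    ← intervalIntegral.integral_of_le (by linarith),
    intervalIntegral.integral_comp_add_left h w, ← sub_eq_add_neg]

theorem integral_chiR_mul_cos {a ω : ℝ} (ha : 0 < a) (hω : ω ≠ 0) (w : ℝ) :
    ∫ v, chiR a v * cos (ω * (w + v)) =
      2 * sin (ω * (a / 2)) / (a * ω) * cos (ω * w) := by
  rw [integral_chiR_mul_comp_add ha fun u => cos (ω * u)]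
  have : ∫ u in (w - a / 2)..(w + a / 2), cos (ω * u) =
      ω⁻¹ * (sin (ω * (w + a / 2)) - sin (ω * (w - a / 2))) := by
    rw [intervalIntegral.integral_comp_mul_left (fun x => cos x) hω, integral_cos, smul_eq_mul]
  rw [this, mul_add ω, mul_sub ω, sin_add, sin_sub]
  field_simp
  ring

theorem integral_chiRK_mul_cos {a ω : ℝ} (ha : 0 < a) (hω : ω ≠ 0) (k : ℕ) :
    ∫ u, chiRK a (k + 1) u * cos (ω * u) =
      (2 * sin (ω * (a / 2)) / (a * ω)) ^ (k + 1) := by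
  induction k with
  | zero => simpa [chiRK] using integral_chiR_mul_cos ha hω 0
  | succ k ih =>
    have h := integral_rconv_mul (integrable_chiR a) (integrable_chiRK a k)
      (h := fun u => cos (ω * u)) (by fun_prop) (fun x => abs_cos_le_one _)
    simp only [integral_chiR_mul_cos ha hω] at h
    refine h.trans ?_
    rw [pow_succ', ← ih, ← integral_const_mul]
    congr 1
    funext u
    ring

/-! ### The square wave and the triangle wave -/

theorem measurable_real_sign : Measurable Real.sign := by
  unfold Real.sign
  exact Measurable.ite measurableSet_Iio measurable_const
    (Measurable.ite measurableSet_Ioi measurable_const measurable_const)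

theorem abs_real_sign_le_one (x : ℝ) : |Real.sign x| ≤ 1 := by
  rcases Real.sign_apply_eq x with h | h | h <;> simp [h]

theorem countable_cos_pi_mul_eq_zero : {x : ℝ | cos (π * x) = 0}.Countable := by
  refine (Set.countable_range fun n : ℤ => (2 * (n : ℝ) + 1) / 2).mono ?_
  intro x hx
  obtain ⟨n, hn⟩ := cos_eq_zero_iff.1 hx
  refine ⟨n, ?_⟩
  have := pi_ne_zero
  dsimp only
  field_simp at hn
  linarith

theorem hasDerivAt_arcsin_sin_pi_mul {x : ℝ} (hx : cos (π * x) ≠ 0) :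
    HasDerivAt (fun x => arcsin (sin (π * x)) / π) (Real.sign (cos (π * x))) x := by
  have hsq := sin_sq_add_cos_sq (π * x)
  have hpos : 0 < cos (π * x) ^ 2 := by positivity
  have h₁ : sin (π * x) ≠ -1 := fun h => by rw [h] at hsq; linarith
  have h₂ : sin (π * x) ≠ 1 := fun h => by rw [h] at hsq; linarith
  have hd : HasDerivAt (fun x : ℝ => π * x) π x := by
    simpa using (hasDerivAt_id x).const_mul π
  have := ((hasDerivAt_arcsin h₁ h₂).comp x hd.sin).div_const π
  refine this.congr_deriv ?_
  have hs : √(1 - sin (π * x) ^ 2) = |cos (π * x)| := by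
    rw [← sqrt_sq_eq_abs]
    congr 1
    linarith
  rw [hs]
  rcases lt_or_gt_of_ne hx with h | h
  · rw [abs_of_neg h, Real.sign_of_neg h]
    field_simp
  · rw [abs_of_pos h, Real.sign_of_pos h]
    field_simp

theorem measurable_sign_cos : Measurable fun x : ℝ => Real.sign (cos (π * x)) :=
  measurable_real_sign.comp (by fun_prop)

theorem integral_sign_cos (p q : ℝ) :
    ∫ u in p..q, Real.sign (cos (π * u)) =
      arcsin (sin (π * q)) / π - arcsin (sin (π * p)) / π := by
  refine integral_eq_of_hasDerivAt_off_countable (fun x => arcsin (sin (π * x)) / π) _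
    countable_cos_pi_mul_eq_zero ?_ (fun x hx => hasDerivAt_arcsin_sin_pi_mul hx.2) ?_
  · exact ((continuous_arcsin.comp (by fun_prop)).div_const π).continuousOn
  · refine (intervalIntegrable_const (c := (1 : ℝ))).mono_fun
      measurable_sign_cos.aestronglyMeasurable
      (Filter.Eventually.of_forall fun x => ?_)
    simpa using abs_real_sign_le_one _

theorem integral_chiR_mul_sign_cos (j : ℕ) (w : ℝ) :
    ∫ v, chiR (2 * (j : ℝ) + 1) v * Real.sign (cos (π * (w + v))) =
      (-1) ^ j * (2 / (π * (2 * (j : ℝ) + 1))) * arcsin (cos (π * w)) := by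
  have ha : (0 : ℝ) < 2 * j + 1 := by positivity
  rw [integral_chiR_mul_comp_add ha fun u => Real.sign (cos (π * u)), integral_sign_cos]
  have e₁ : sin (π * (w + (2 * (j : ℝ) + 1) / 2)) = (-1) ^ j * cos (π * w) := by
    rw [show π * (w + (2 * (j : ℝ) + 1) / 2) = π * w + j * π + π / 2 by ring,
      sin_add_pi_div_two, cos_add_nat_mul_pi]
  have e₂ : sin (π * (w - (2 * (j : ℝ) + 1) / 2)) = -((-1) ^ j * cos (π * w)) := by
    rw [show π * (w - (2 * (j : ℝ) + 1) / 2) = π * w - j * π - π / 2 by ring,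
      sin_sub_pi_div_two, cos_sub_nat_mul_pi]
  have e₃ : arcsin ((-1) ^ j * cos (π * w)) = (-1) ^ j * arcsin (cos (π * w)) := by
    rcases neg_one_pow_eq_or ℝ j with h | h <;> simp [h, arcsin_neg]
  rw [e₁, e₂, arcsin_neg, e₃]
  field_simp
  ring

theorem hasSum_odd_of_hasSum {f : ℕ → ℝ} {s t : ℝ} (hf : HasSum f s)
    (he : HasSum (fun n => f (2 * n)) t) : HasSum (fun n => f (2 * n + 1)) (s - t) := by
  have ho : Summable fun n => f (2 * n + 1) :=
    hf.summable.comp_injective (i := fun n => 2 * n + 1) fun m n h => by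
      simpa using h
  have := (he.even_add_odd ho.hasSum).unique hf
  rw [← this, add_sub_cancel_left]
  exact ho.hasSum

theorem hasSum_cos_div_sq {x : ℝ} (hx : x ∈ Set.Icc (0 : ℝ) 1) :
    HasSum (fun n : ℕ => 1 / (n : ℝ) ^ 2 * cos (2 * π * n * x))
      (π ^ 2 * (x ^ 2 - x + 1 / 6)) := by
  convert! hasSum_one_div_nat_pow_mul_cos one_ne_zero hx using 1
  have : Polynomial.eval x (Polynomial.map (algebraMap ℚ ℝ) (Polynomial.bernoulli (2 * 1))) =
      x ^ 2 - x + 1 / 6 := by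
    simp only [Polynomial.bernoulli, Finset.sum_range_succ, Polynomial.eval_map,
      Polynomial.eval₂_add, Polynomial.eval₂_monomial]
    norm_num [Finset.sum_range_succ, bernoulli, bernoulli'_two, bernoulli'_one, Nat.choose]
    ring
  rw [this, show Nat.factorial (2 * 1) = 2 from rfl]
  push_cast
  ring

/-- The Fourier series of the triangle wave. -/
theorem hasSum_cos_odd (θ : ℝ) :
    HasSum (fun n : ℕ => 4 / π * (1 / (2 * (n : ℝ) + 1) ^ 2 * cos ((2 * n + 1) * θ)))
      (arcsin (cos θ)) := by
  set φ := arccos (cos θ) with hφ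
  have hcos : ∀ n : ℕ, cos (n * φ) = cos (n * θ) := fun n => by
    have h₁ := Polynomial.Chebyshev.T_real_cos φ n
    have h₂ := Polynomial.Chebyshev.T_real_cos θ n
    rw [hφ, cos_arccos (neg_one_le_cos θ) (cos_le_one θ), h₂] at h₁
    exact_mod_cast h₁.symm
  have h0 : 0 ≤ φ := arccos_nonneg _
  have h1 : φ ≤ π := arccos_le_pi _
  have hpi := pi_pos
  have hs₁ := hasSum_cos_div_sq (x := φ / (2 * π))
    ⟨by positivity, by rw [div_le_one (by positivity)]; linarith⟩
  have hs₂ := hasSum_cos_div_sq (x := φ / π)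
    ⟨by positivity, by rw [div_le_one (by positivity)]; linarith⟩
  have he : HasSum (fun n : ℕ => 1 / ((2 * n : ℕ) : ℝ) ^ 2 *
      cos (2 * π * (2 * n : ℕ) * (φ / (2 * π))))
      (1 / 4 * (π ^ 2 * ((φ / π) ^ 2 - φ / π + 1 / 6))) := by
    convert! hs₂.mul_left (1 / 4) using 2 with n
    rw [show 2 * π * (2 * n : ℕ) * (φ / (2 * π)) = 2 * π * n * (φ / π) by
      push_cast; field_simp]
    push_cast
    rw [mul_pow, ← mul_assoc, one_div_mul_one_div]
    norm_num
  have ho := (hasSum_odd_of_hasSum hs₁ he).mul_left (4 / π)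
  have hv : 4 / π * (π ^ 2 * ((φ / (2 * π)) ^ 2 - φ / (2 * π) + 1 / 6) -
      1 / 4 * (π ^ 2 * ((φ / π) ^ 2 - φ / π + 1 / 6))) = arcsin (cos θ) := by
    rw [show arcsin (cos θ) = π / 2 - φ by rw [hφ, arccos]; ring]
    field_simp
    ring
  rw [hv] at ho
  convert! ho using 4 with n
  · push_cast; rfl
  · have := hcos (2 * n + 1)
    push_cast at this
    rw [← this]
    congr 1
    push_cast
    field_simp

theorem summable_one_div_odd_pow {p : ℕ} (hp : 2 ≤ p) :
    Summable fun n : ℕ => 1 / (2 * (n : ℝ) + 1) ^ p := by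
  have := (Real.summable_one_div_nat_pow.2 (by omega : 1 < p)).comp_injective
    (i := fun n => 2 * n + 1) fun m n h => by simpa using h
  refine this.congr fun n => ?_
  simp

theorem favard_eq_of_odd {k : ℕ} (hk : Odd k) :
    favard k = 4 / π * ∑' n : ℕ, 1 / (2 * (n : ℝ) + 1) ^ (k + 1) := by
  have hs := summable_one_div_odd_pow (p := k + 1) (by have := hk.pos; omega)
  set f : ℕ → ℝ := fun n => 1 / (2 * (n : ℝ) + 1) ^ (k + 1) with hf
  have he : Summable fun n => f (2 * n) :=
    hs.comp_injective (i := fun n : ℕ => 2 * n) fun m n h => by simpa using h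
  have ho : Summable fun n => f (2 * n + 1) :=
    hs.comp_injective (i := fun n : ℕ => 2 * n + 1) fun m n h => by simpa using h
  have hz : HasSum (fun m : ℤ => 1 / (4 * (m : ℝ) + 1) ^ (k + 1))
      ((∑' n, f (2 * n)) + ∑' n, f (2 * n + 1)) := by
    refine HasSum.of_nat_of_neg_add_one ?_ ?_
    · have e : (fun n : ℕ => 1 / (4 * ((n : ℤ) : ℝ) + 1) ^ (k + 1)) = fun n => f (2 * n) := by
        funext n
        simp only [hf]
        push_cast
        rw [← mul_assoc]
        norm_num
      rw [e]
      exact he.hasSum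
    · have e : (fun n : ℕ => 1 / (4 * ((-((n : ℤ) + 1) : ℤ) : ℝ) + 1) ^ (k + 1)) =
          fun n => f (2 * n + 1) := by
        funext n
        simp only [hf]
        rw [← hk.add_one.neg_pow]
        push_cast
        congr 2
        ring
      rw [e]
      exact ho.hasSum
  rw [favard, hz.tsum_eq, (he.hasSum.even_add_odd ho.hasSum).tsum_eq]

theorem sin_odd_mul_pi_mul_odd_div_two (j n : ℕ) :
    sin ((2 * (n : ℝ) + 1) * π * ((2 * (j : ℝ) + 1) / 2)) = (-1) ^ j * (-1) ^ n := by
  rw [show (2 * (n : ℝ) + 1) * π * ((2 * (j : ℝ) + 1) / 2) =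
      ((2 * n * j + n + j : ℕ) : ℝ) * π + π / 2 by push_cast; ring,
    sin_add_pi_div_two, cos_nat_mul_pi, pow_add, pow_add, mul_assoc 2, pow_mul]
  norm_num
  ring

theorem hasSum_integral_mul_arcsin_cos {g : ℝ → ℝ} (hg : Integrable g) :
    HasSum (fun n : ℕ => 4 / π * (1 / (2 * (n : ℝ) + 1) ^ 2 *
        ∫ u, g u * cos ((2 * n + 1) * π * u)))
      (∫ u, g u * arcsin (cos (π * u))) := by
  set F : ℕ → ℝ → ℝ := fun n u =>
    4 / π * (1 / (2 * (n : ℝ) + 1) ^ 2 * (g u * cos ((2 * n + 1) * π * u))) with hF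
  have hint : ∀ n, Integrable (F n) := fun n =>
    ((hg.mul_bdd (c := 1) (by fun_prop)
      (Filter.Eventually.of_forall fun u => abs_cos_le_one _)).const_mul _).const_mul _
  have hsum : Summable fun n => ∫ u, ‖F n u‖ := by
    refine Summable.of_nonneg_of_le (fun n => integral_nonneg fun u => norm_nonneg _)
      (fun n => ?_)
      (((summable_one_div_odd_pow le_rfl).mul_left (4 / π)).mul_right (∫ u, ‖g u‖))
    rw [← integral_const_mul]
    refine integral_mono (hint n).norm (hg.norm.const_mul _) fun u => ?_
    have hc : 0 ≤ 4 / π * (1 / (2 * (n : ℝ) + 1) ^ 2) := by positivity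
    simp only [hF]
    rw [← mul_assoc, norm_mul, Real.norm_of_nonneg hc, norm_mul]
    exact mul_le_mul_of_nonneg_left
      (mul_le_of_le_one_right (norm_nonneg _) (abs_cos_le_one _)) hc
  have h := hasSum_integral_of_summable_integral_norm hint hsum
  have e₁ : (fun n => ∫ u, F n u) = fun n : ℕ => 4 / π * (1 / (2 * (n : ℝ) + 1) ^ 2 *
        ∫ u, g u * cos ((2 * n + 1) * π * u)) := by
    funext n
    rw [← integral_const_mul, ← integral_const_mul]
  have e₂ : (fun u => ∑' n, F n u) = fun u => g u * arcsin (cos (π * u)) := by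
    funext u
    rw [← ((hasSum_cos_odd (π * u)).mul_left (g u)).tsum_eq]
    refine tsum_congr fun n => ?_
    simp only [hF, mul_assoc]
    ring
  rwa [e₁, e₂] at h

/-- The integral of a B-spline against the square wave, as a series in the Fourier multipliers
of the normalized indicator. -/
theorem hasSum_integral_chiRK_mul_sign_cos (j K : ℕ) :
    HasSum (fun n : ℕ => (-1) ^ j * (2 / (π * (2 * (j : ℝ) + 1))) *
        (4 / π * (1 / (2 * (n : ℝ) + 1) ^ 2 *
          (2 * ((-1) ^ j * (-1) ^ n) / ((2 * (j : ℝ) + 1) * ((2 * n + 1) * π))) ^ K)))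
      (∫ u, chiRK (2 * (j : ℝ) + 1) (K + 1) u * Real.sign (cos (π * u))) := by
  have ha : (0 : ℝ) < 2 * j + 1 := by positivity
  cases K with
  | zero =>
    have h := integral_chiR_mul_sign_cos j 0
    simp only [zero_add, mul_zero] at h
    simp only [chiRK]
    rw [h]
    simpa using (hasSum_cos_odd 0).mul_left ((-1) ^ j * (2 / (π * (2 * (j : ℝ) + 1))))
  | succ K =>
    have h := integral_rconv_mul (integrable_chiR (2 * (j : ℝ) + 1))
      (integrable_chiRK (2 * (j : ℝ) + 1) K) measurable_sign_cos
      (fun x => abs_real_sign_le_one _)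
    simp only [integral_chiR_mul_sign_cos] at h
    have h' : ∫ u, chiRK (2 * (j : ℝ) + 1) (K + 1 + 1) u * Real.sign (cos (π * u)) =
        (-1) ^ j * (2 / (π * (2 * (j : ℝ) + 1))) *
          ∫ u, chiRK (2 * (j : ℝ) + 1) (K + 1) u * arcsin (cos (π * u)) := by
      refine h.trans ?_
      rw [← integral_const_mul]
      congr 1
      funext u
      ring
    rw [h']
    have hs := (hasSum_integral_mul_arcsin_cos (integrable_chiRK (2 * (j : ℝ) + 1) K)).mul_left
      ((-1) ^ j * (2 / (π * (2 * (j : ℝ) + 1))))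
    have hω : ∀ n : ℕ, (2 * (n : ℝ) + 1) * π ≠ 0 := fun n => by positivity
    simp only [integral_chiRK_mul_cos ha (hω _), sin_odd_mul_pi_mul_odd_div_two] at hs
    exact hs

theorem integral_Bspline_sign_cos_odd (k : ℕ) (hk : Odd k) (j : ℕ) :
    ∫ u : ℝ, chiRK (2 * (j : ℝ) + 1) k u *
        ((-1 : ℝ) ^ j * Real.sign (Real.cos (π * u)))
      = Fconst k / (2 * (j : ℝ) + 1) ^ k := by
  obtain ⟨K, rfl⟩ : ∃ K, k = K + 1 := ⟨k - 1, by have := hk.pos; omega⟩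
  have hK : Even K := by
    rcases Nat.even_or_odd K with h | h
    · exact h
    · exact absurd h.add_one (Nat.not_even_iff_odd.2 hk)
  have hj : ((-1 : ℝ) ^ j) * (-1) ^ j = 1 := by rw [← mul_pow]; norm_num
  have hint : ∫ u : ℝ, chiRK (2 * (j : ℝ) + 1) (K + 1) u *
        ((-1 : ℝ) ^ j * Real.sign (Real.cos (π * u))) =
      (-1) ^ j * ∫ u, chiRK (2 * (j : ℝ) + 1) (K + 1) u * Real.sign (cos (π * u)) := by
    rw [← integral_const_mul]
    congr 1
    funext u
    ring
  rw [hint, ← (hasSum_integral_chiRK_mul_sign_cos j K).tsum_eq, Fconst, favard_eq_of_odd hk,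
    ← tsum_mul_left, ← tsum_mul_left, ← tsum_mul_left, ← tsum_div_const]
  refine tsum_congr fun n => ?_
  have hsq : (((-1 : ℝ) ^ j) * (-1) ^ n) ^ K = 1 := by
    rw [← pow_add, ← pow_mul]
    exact (hK.mul_left _).neg_one_pow
  have hn : (2 * (n : ℝ) + 1) ≠ 0 := by positivity
  have ha : (2 * (j : ℝ) + 1) ≠ 0 := by positivity
  rw [div_pow, mul_pow, hsq, ← mul_assoc, ← mul_assoc ((-1 : ℝ) ^ j) ((-1) ^ j), hj, mul_pow, mul_pow, div_pow]
  have := pi_ne_zero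
  field_simp
  ring
end
end
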